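/- arXiv:2009.07028 — 3 statements merged into one kernel-verified Lean document; each statement's English description precedes it below -/
import Mathlib

section
/- Let D ≡ 0 or 1 (mod 4) be a non-square integer with D ∉ {-3, -4}, d = |D|, and let q₁ < q₂ < ⋯ be the primes q with Kronecker symbol (D/q) = -1. If n₀ is the turning index, i.e. the unique n with q₁⋯qₙ < d < q₁⋯qₙ₊₁, then q_{n₀+1} < d. -/
/-- Kronecker symbol `(D/q)` at a prime `q`, for discriminants `D ≡ 0,1 (mod 4)`. -/
def kron (D : ℤ) (q : ℕ) : ℤ :=
  if q = 2 then (if D % 8 = 1 then 1 else if D % 8 = 5 then -1 else 0)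
  else jacobiSym D q

/-- If a multiplicative, `d`-periodic function `χ : ℤ → {0, 1, -1}` vanishes exactly at the primes
dividing `d > 4`, where `d` is odd or divisible by `4`, then a squarefree `Q > 1` whose prime
divisors are precisely the primes `p < d` with `χ p = -1` cannot be smaller than `d`. -/
theorem false_of_squarefree_lt (χ : ℤ → ℤ) (d : ℤ) (Q : ℕ)
    (hmul : ∀ a b, χ (a * b) = χ a * χ b) (hper : ∀ a k, χ (k * d + a) = χ a)
    (h1 : χ 1 = 1) (htri : ∀ a, χ a = 0 ∨ χ a = 1 ∨ χ a = -1)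
    (hzero : ∀ p : ℕ, p.Prime → (χ p = 0 ↔ (p : ℤ) ∣ d))
    (hd4 : 4 < d) (hpar : d % 2 = 1 ∨ d % 4 = 0)
    (hQ1 : 1 < Q) (hQd : (Q : ℤ) < d) (hsq : Squarefree Q)
    (hQ : ∀ p : ℕ, p.Prime → (p ∣ Q ↔ (p : ℤ) < d ∧ χ p = -1)) : False := by
  have hχQ : ∀ q : ℕ, q.Prime → q ∣ Q → χ q = -1 := fun q hq h => ((hQ q hq).1 h).2
  have hndvd : ∀ q : ℕ, q.Prime → q ∣ Q → ¬ (q : ℤ) ∣ d := fun q hq h hd => by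
    have := (hzero q hq).2 hd
    rw [hχQ q hq h] at this
    norm_num at this
  have hfac : ∀ n : ℕ, χ n = -1 → ∃ q : ℕ, q.Prime ∧ q ∣ n ∧ χ q = -1 := by
    intro n
    induction n using Nat.recOnMul with
    | zero =>
      intro h
      have h0 := hmul 0 0
      rw [mul_zero, ← Nat.cast_zero, h] at h0
      norm_num at h0
    | one => intro h; simp [h1] at h
    | prime p hp => exact fun h => ⟨p, hp, dvd_rfl, h⟩
    | mul a b iha ihb =>
      intro h
      push_cast at h
      rw [hmul] at h
      by_cases ha : χ a = -1
      · obtain ⟨q, hq, hqa, hc⟩ := iha ha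
        exact ⟨q, hq, hqa.mul_right b, hc⟩
      by_cases hb : χ b = -1
      · obtain ⟨q, hq, hqa, hc⟩ := ihb hb
        exact ⟨q, hq, hqa.mul_left a, hc⟩
      rcases htri a with h' | h' | h' <;> rcases htri b with h'' | h'' | h'' <;> simp_all
  have hnz : ∀ n : ℕ, n ∣ Q → χ n ≠ 0 := by
    intro n
    induction n using Nat.recOnMul with
    | zero => intro h; rw [zero_dvd_iff] at h; omega
    | one => intro _; simp [h1]
    | prime p hp => intro h; simp [hχQ p hp h]
    | mul a b iha ihb =>
      intro h
      push_cast
      rw [hmul]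
      exact mul_ne_zero (iha (dvd_of_mul_right_dvd h)) (ihb (dvd_of_mul_left_dvd h))
  have hhit : ∀ r : ℤ, 0 < r → r < d → χ r = -1 → ∃ q : ℕ, q.Prime ∧ q ∣ Q ∧ (q : ℤ) ∣ r := by
    intro r hr hrd hχ
    lift r to ℕ using hr.le
    obtain ⟨q, hq, hqr, hc⟩ := hfac r hχ
    have := Nat.le_of_dvd (by omega) hqr
    exact ⟨q, hq, (hQ q hq).2 ⟨by omega, hc⟩, Int.natCast_dvd_natCast.2 hqr⟩
  have hhitQ : ∀ x y : ℤ, (∀ q : ℕ, q.Prime → q ∣ Q → ¬ (q : ℤ) ∣ x) →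
      0 < x + y * Q → x + y * Q < d → χ (x + y * Q) ≠ -1 := by
    intro x y hx h0 hlt hc
    obtain ⟨q, hq, hqQ, hqr⟩ := hhit _ h0 hlt hc
    exact hx q hq hqQ ((dvd_add_left
      ((Int.natCast_dvd_natCast.2 hqQ).mul_left y)).1 hqr)
  have hhitA : ∀ q A : ℕ, q.Prime → Q = q * A → ∀ x y : ℤ,
      (∀ q : ℕ, q.Prime → q ∣ Q → ¬ (q : ℤ) ∣ x) →
      0 < x + y * A → x + y * A < d → χ (x + y * A) = -1 → (q : ℤ) ∣ x + y * A := by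
    intro q A hq hqA x y hx h0 hlt hc
    obtain ⟨p, hp, hpQ, hpr⟩ := hhit _ h0 hlt hc
    rcases (hp.dvd_mul).1 (hqA ▸ hpQ) with h | h
    · rwa [(Nat.prime_dvd_prime_iff_eq hp hq).1 h] at hpr
    · exact absurd ((dvd_add_left ((Int.natCast_dvd_natCast.2 h).mul_left y)).1 hpr) (hx p hp hpQ)
  have hsub : ∀ a, χ (d + a) = χ a := fun a => by simpa using hper a 1
  have hneg : χ (-1) * χ (-1) = 1 := by rw [← hmul]; simpa using h1
  have hnegmul : ∀ a, χ (-a) = χ (-1) * χ a := fun a => by rw [← hmul]; simp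
  have hχnegQ : χ (-Q) = 1 := by
    rcases htri (-Q) with h | h | h
    · rw [hnegmul] at h
      rcases mul_eq_zero.1 h with h | h
      · simp [h] at hneg
      · exact absurd h (hnz Q dvd_rfl)
    · exact h
    · exact absurd (by rw [hsub]; simpa using h)
        (hhitQ d (-1) hndvd (by linarith) (by linarith))
  have hχnegA : ∀ q A : ℕ, q.Prime → Q = q * A → χ (-A) = -1 := by
    intro q A hq hqA
    have h : χ (-Q) = χ q * χ (-A) := by rw [← hmul, hqA]; push_cast; ring_nf
    rw [hχnegQ, hχQ q hq ⟨A, hqA⟩] at h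
    linarith
  have hApos : ∀ q A : ℕ, Q = q * A → 0 < A := fun q A hqA =>
    Nat.pos_of_ne_zero (by rintro rfl; omega)
  have hdA : ∀ q A : ℕ, q.Prime → Q = q * A → (q : ℤ) ∣ d + (-1) * A := by
    intro q A hq hqA
    have hA := hApos q A hqA
    have : A ≤ Q := Nat.le_of_dvd (by omega) ⟨q, by rw [hqA]; ring⟩
    refine hhitA q A hq hqA d (-1) hndvd (by omega) (by omega) ?_
    rw [hsub, neg_one_mul, hχnegA q A hq hqA]
  rcases hpar with hodd | h4
  · have h2d : ¬ ((2 : ℕ) : ℤ) ∣ d := by omega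
    have h2nz : χ 2 ≠ 0 := fun h => h2d ((hzero 2 Nat.prime_two).1 h)
    rcases htri 2 with h2 | h2 | h2
    · exact h2nz h2
    · obtain ⟨q, hq, A, hqA⟩ := Nat.exists_prime_and_dvd (n := Q) (by omega)
      have hq2 : q ≠ 2 := by
        rintro rfl
        have := hχQ 2 hq ⟨A, hqA⟩
        norm_num [h2] at this
      have hq3 : 3 ≤ q := by have := hq.two_le; omega
      have hA : 3 * A ≤ Q := by rw [hqA]; gcongr
      have hA0 := hApos q A hqA
      have hb := hhitA q A hq hqA d (-2) hndvd (by omega) (by omega) (by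
        rw [hsub, show (-2 : ℤ) * A = 2 * -A by ring, hmul, h2, hχnegA q A hq hqA]; rfl)
      have := dvd_sub ((hdA q A hq hqA).mul_left 2) hb
      rw [show 2 * (d + -1 * (A : ℤ)) - (d + -2 * A) = d by ring] at this
      exact hndvd q hq ⟨A, hqA⟩ this
    · have h2Q : 2 ∣ Q := (hQ 2 Nat.prime_two).2 ⟨by push_cast; linarith, h2⟩
      by_cases hex : ∃ q : ℕ, q.Prime ∧ q ∣ Q ∧ 5 ≤ q
      · obtain ⟨q, hq, ⟨A, hqA⟩, hq5⟩ := hex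
        have hA : 5 * A ≤ Q := by rw [hqA]; gcongr
        have hA0 := hApos q A hqA
        have hb := hhitA q A hq hqA d (-4) hndvd (by omega) (by omega) (by
          rw [hsub, show (-4 : ℤ) * A = 2 * (2 * -A) by ring, hmul, hmul, h2, hχnegA q A hq hqA]
          rfl)
        have := dvd_sub ((hdA q A hq hqA).mul_left 4) hb
        rw [show 4 * (d + -1 * (A : ℤ)) - (d + -4 * A) = (3 : ℕ) * d by push_cast; ring] at this
        rcases (Nat.prime_iff_prime_int.1 hq).dvd_or_dvd this with h | h
        · have := Nat.le_of_dvd (by norm_num) (Int.natCast_dvd_natCast.1 h)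
          omega
        · exact hndvd q hq ⟨A, hqA⟩ h
      · push Not at hex
        have hQ6 : Q ∣ 6 := by
          rw [← Nat.prod_primeFactors_of_squarefree hsq]
          refine Finset.prod_primes_dvd 6 (fun p hp => (Nat.prime_of_mem_primeFactors hp).prime) ?_
          intro p hp
          have hpp := Nat.prime_of_mem_primeFactors hp
          have := hex p hpp (Nat.dvd_of_mem_primeFactors hp)
          interval_cases p <;> first | decide | (revert hpp; decide)
        have hQle := Nat.le_of_dvd (by norm_num) hQ6
        rcases lt_or_ge (2 * (Q : ℤ)) d with h | h
        · refine hhitQ d (-2) hndvd (by omega) (by omega) ?_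
          rw [hsub, show (-2 : ℤ) * Q = 2 * -Q by ring, hmul, h2, hχnegQ]; rfl
        · have hQ6' : Q = 6 := by
            interval_cases Q <;> omega
          subst hQ6'
          have h3 := hχQ 3 Nat.prime_three (by norm_num)
          refine hhitQ (-d) 2 (fun q hq hqQ h => hndvd q hq hqQ ((dvd_neg).1 h))
            (by push_cast; omega) (by push_cast at *; omega) ?_
          have := hper (2 * (6 : ℕ)) (-1)
          rw [neg_one_mul] at this
          rw [this, show (2 : ℤ) * (6 : ℕ) = 2 * (2 * (3 : ℕ)) by norm_num, hmul, hmul, h2, h3]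
          rfl
  · obtain ⟨e, rfl⟩ : ∃ e, d = 4 * e := ⟨d / 4, by omega⟩
    have hQ2 : ¬ 2 ∣ Q := fun h => hndvd 2 Nat.prime_two h ⟨2 * e, by push_cast; ring⟩
    have hn2e : ∀ q : ℕ, q.Prime → q ∣ Q → ¬ (q : ℤ) ∣ 2 * e := fun q hq hqQ h =>
      hndvd q hq hqQ (by rw [show 4 * e = 2 * (2 * e) by ring]; exact h.mul_left 2)
    have hhalf : ∀ v : ℤ, v % 2 = 1 → χ (2 * e + v) = χ (1 + 2 * e) * χ v := by
      intro v hv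
      obtain ⟨w, rfl⟩ : ∃ w, v = 2 * w + 1 := ⟨v / 2, by omega⟩
      rw [← hmul, ← hper (2 * e + (2 * w + 1)) w]
      congr 1; ring
    have hε : χ (1 + 2 * e) * χ (1 + 2 * e) = 1 := by
      rw [← hmul, show (1 + 2 * e) * (1 + 2 * e) = (1 + e) * (4 * e) + 1 by ring, hper, h1]
    have hodd : ∀ q A : ℕ, Q = q * A → (A : ℤ) % 2 = 1 := by
      intro q A hqA
      have : ¬ 2 ∣ A := fun h => hQ2 (hqA ▸ h.mul_left q)
      omega
    have hthree : ∀ q A : ℕ, q.Prime → Q = q * A → 3 * A ≤ Q := by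
      intro q A hq hqA
      have : q ≠ 2 := by rintro rfl; exact hQ2 ⟨A, hqA⟩
      have hq3 : 3 ≤ q := by have := hq.two_le; omega
      rw [hqA]; gcongr
    rcases mul_self_eq_one_iff.1 hε with hε | hε
    · obtain ⟨q, hq, A, hqA⟩ := Nat.exists_prime_and_dvd (n := Q) (by omega)
      have hA := hthree q A hq hqA
      have hA2 := hodd q A hqA
      have hA0 := hApos q A hqA
      have hb := hhitA q A hq hqA (2 * e) (-1) hn2e (by omega) (by omega) (by
        rw [hhalf _ (by omega), hε, neg_one_mul, hχnegA q A hq hqA]; rfl)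
      have := dvd_sub (hdA q A hq hqA) hb
      rw [show 4 * e + -1 * (A : ℤ) - (2 * e + -1 * A) = 2 * e by ring] at this
      exact hn2e q hq ⟨A, hqA⟩ this
    · rcases lt_or_ge (Q : ℤ) (2 * e) with hlt | hge
      · refine hhitQ (2 * e) (-1) hn2e (by omega) (by omega) ?_
        rw [hhalf _ (by omega), hε, neg_one_mul (Q : ℤ), hχnegQ]; rfl
      rcases mul_self_eq_one_iff.1 hneg with hσ | hσ
      · refine hhitQ (-(2 * e)) 1 (fun q hq hqQ h => hn2e q hq hqQ ((dvd_neg).1 h))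
          (by omega) (by omega) ?_
        rw [show -(2 * e) + 1 * (Q : ℤ) = -(2 * e + -Q) by ring, hnegmul, hσ, hhalf _ (by omega),
          hε, hχnegQ]
        rfl
      · obtain ⟨q, hq, ⟨A, hqA⟩, hq3⟩ : ∃ q : ℕ, q.Prime ∧ q ∣ Q ∧ q ≠ 3 := by
          by_contra! hex
          have hQ3 : Q ∣ 3 := by
            rw [← Nat.prod_primeFactors_of_squarefree hsq]
            refine Finset.prod_primes_dvd 3
              (fun p hp => (Nat.prime_of_mem_primeFactors hp).prime) fun p hp => ?_
            rw [hex p (Nat.prime_of_mem_primeFactors hp) (Nat.dvd_of_mem_primeFactors hp)]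
          have := Nat.le_of_dvd (by norm_num) hQ3
          omega
        have hA := hthree q A hq hqA
        have hA2 := hodd q A hqA
        have hA0 := hApos q A hqA
        have hχA : χ A = 1 := by
          have := hχnegA q A hq hqA
          rw [hnegmul, hσ] at this
          linarith
        have hb := hhitA q A hq hqA (2 * e) 1 hn2e (by omega) (by omega) (by
          rw [hhalf _ (by omega), hε, one_mul, hχA]; rfl)
        have := dvd_add (hdA q A hq hqA) hb
        rw [show 4 * e + -1 * (A : ℤ) + (2 * e + 1 * A) = (3 : ℕ) * (2 * e) by push_cast; ring]
          at this
        rcases (Nat.prime_iff_prime_int.1 hq).dvd_or_dvd this with h | h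
        · exact hq3 ((Nat.prime_dvd_prime_iff_eq hq Nat.prime_three).1 (Int.natCast_dvd_natCast.1 h))
        · exact hn2e q hq ⟨A, hqA⟩ h

/-- For a discriminant `D ≠ 0`, the Kronecker symbol `(D/·)` extends from the primes to a
multiplicative function on `ℤ` that is periodic modulo `|D|`. -/
theorem exists_periodic_mul_eq_kron (D : ℤ) (hD : D % 4 = 0 ∨ D % 4 = 1) (hD0 : D ≠ 0) :
    ∃ χ : ℤ → ℤ, (∀ a b, χ (a * b) = χ a * χ b) ∧
      (∀ a k, χ (k * (D.natAbs : ℤ) + a) = χ a) ∧ χ 1 = 1 ∧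
      (∀ a, χ a = 0 ∨ χ a = 1 ∨ χ a = -1) ∧
      (∀ p : ℕ, p.Prime → (χ p = 0 ↔ (p : ℤ) ∣ (D.natAbs : ℤ))) ∧
      ∀ p : ℕ, p.Prime → χ p = kron D p := by
  have hgcd : ∀ p : ℕ, p.Prime → (Nat.gcd p D.natAbs ≠ 1 ↔ (p : ℤ) ∣ (D.natAbs : ℤ)) := by
    intro p hp
    rw [Int.natCast_dvd_natCast, ← not_iff_not, not_not]
    exact hp.coprime_iff_not_dvd
  rcases hD with hD | hD
  · have hdvd : ∀ m : ℤ, m % D.natAbs % 2 = m % 2 := fun m =>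
      Int.emod_emod_of_dvd m (by omega)
    have hpos : ∀ m : ℤ, 0 ≤ m % D.natAbs := fun m => Int.emod_nonneg _ (by omega)
    have hmod : ∀ n : ℕ, n % 2 = 1 → jacobiSym D n = jacobiSym D (n % D.natAbs) := by
      intro n hn
      have h4 : 4 * (D / 4).natAbs = D.natAbs := by omega
      rw [← jacobiSym.div_four_left hD hn, jacobiSym.mod_right _ (Nat.odd_iff.2 hn), h4,
        jacobiSym.div_four_left hD]
      rw [Nat.mod_mod_of_dvd n (by omega)]
      exact hn
    set χ : ℤ → ℤ := fun m => if m % 2 = 0 then 0 else jacobiSym D (m % D.natAbs).toNat with hχ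
    have heven : ∀ m : ℤ, m % 2 = 0 → χ m = 0 := fun m hm => if_pos hm
    have hodd : ∀ m : ℤ, m % 2 = 1 → χ m = jacobiSym D (m % D.natAbs).toNat :=
      fun m hm => if_neg (by omega)
    have hnat : ∀ n : ℕ, n % 2 = 1 → χ n = jacobiSym D n := by
      intro n hn
      rw [hodd _ (by omega), hmod n hn]
      congr 1
    refine ⟨χ, ?_, ?_, ?_, ?_, ?_, ?_⟩
    · intro a b
      rcases Int.emod_two_eq_zero_or_one a with ha | ha
      · rw [heven a ha, heven _ (by simp [Int.mul_emod, ha]), zero_mul]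
      rcases Int.emod_two_eq_zero_or_one b with hb | hb
      · rw [heven b hb, heven _ (by simp [Int.mul_emod, hb]), mul_zero]
      have ha' := hdvd a
      have hb' := hdvd b
      have ha0 := hpos a
      have hb0 := hpos b
      rw [hodd _ (by simp [Int.mul_emod, ha, hb]), hodd a ha, hodd b hb, Int.mul_emod]
      lift a % (D.natAbs : ℤ) to ℕ using ha0 with x
      lift b % (D.natAbs : ℤ) to ℕ using hb0 with y
      have hx : x % 2 = 1 := by omega
      have hy : y % 2 = 1 := by omega
      simp only [Int.toNat_natCast]
      rw [← jacobiSym.mul_right' D (by omega) (by omega),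
        hmod (x * y) (by simp [Nat.mul_mod, hx, hy])]
      congr 1
    · intro a k
      have hd2 : (k * (D.natAbs : ℤ) + a) % 2 = a % 2 := by
        obtain ⟨c, hc⟩ : (2 : ℤ) ∣ D.natAbs := by omega
        rw [hc, show k * (2 * c) + a = a + 2 * (k * c) by ring, Int.add_mul_emod_self_left]
      simp only [hχ, hd2]
      rw [add_comm, Int.add_mul_emod_self_right]
    · simpa using hnat 1 rfl
    · intro a
      rcases Int.emod_two_eq_zero_or_one a with ha | ha
      · exact Or.inl (heven a ha)
      · rw [hodd a ha]
        exact jacobiSym.trichotomy _ _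
    · intro p hp
      rcases hp.eq_two_or_odd with rfl | h
      · simp only [heven (2 : ℕ) rfl, true_iff]
        omega
      · have : NeZero p := ⟨hp.ne_zero⟩
        rw [hnat p h, jacobiSym.eq_zero_iff_not_coprime, ← hgcd p hp, Int.gcd_comm]
        rfl
    · intro p hp
      rcases hp.eq_two_or_odd with rfl | h
      · rw [heven (2 : ℕ) rfl, kron, if_pos rfl, if_neg (by omega), if_neg (by omega)]
      · rw [hnat p h, kron, if_neg (by omega)]
  · have hdodd : Odd D.natAbs := Nat.odd_iff.2 (by omega)
    have : NeZero D.natAbs := ⟨by omega⟩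
    refine ⟨fun m => jacobiSym m D.natAbs, fun a b => jacobiSym.mul_left a b _, fun a k => ?_,
      jacobiSym.one_left _, fun a => jacobiSym.trichotomy _ _, fun p hp => ?_, fun p hp => ?_⟩
    · exact jacobiSym.mod_left' (by rw [add_comm, Int.add_mul_emod_self_right])
    · rw [← hgcd p hp]
      exact jacobiSym.eq_zero_iff_not_coprime
    · rcases hp.eq_two_or_odd with rfl | h
      · simp only [kron, if_true, Nat.cast_ofNat]
        rw [jacobiSym.at_two hdodd, ZMod.χ₈_nat_eq_if_mod_eight]
        split_ifs <;> omega
      · simp only [kron]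
        rw [if_neg (by omega)]
        have hpo := Nat.odd_iff.2 h
        rcases Int.natAbs_eq D with hs | hs
        · conv_rhs => rw [hs]
          exact (jacobiSym.quadratic_reciprocity_one_mod_four (by omega) hpo).symm
        · conv_rhs => rw [hs]
          rw [jacobiSym.neg _ hpo]
          rcases Nat.odd_mod_four_iff.1 h with h4 | h4
          · rw [ZMod.χ₄_nat_one_mod_four h4, one_mul,
              jacobiSym.quadratic_reciprocity_one_mod_four h4 hdodd]
          · rw [ZMod.χ₄_nat_three_mod_four h4,
              jacobiSym.quadratic_reciprocity_three_mod_four h4 (by omega), neg_one_mul]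

/-- A number satisfying `P` that lies below a nonzero `Nat.nth P n` is `Nat.nth P j` for some
`j < n`. -/
theorem Nat.exists_lt_nth_eq_of_lt_nth {P : ℕ → Prop} {n p : ℕ} (hp : P p)
    (hlt : p < Nat.nth P n) : ∃ j < n, Nat.nth P j = p := by
  obtain ⟨j, hj, rfl⟩ := Nat.exists_lt_card_nth_eq hp
  exact ⟨j, not_le.1 fun h => hlt.not_ge (Nat.nth_le_nth' h hj), rfl⟩

theorem stmt10 (D : ℤ) (hD : D % 4 = 0 ∨ D % 4 = 1) (hns : ¬ IsSquare D)
    (hne3 : D ≠ -3) (hne4 : D ≠ -4) (d : ℕ) (hd : d = D.natAbs)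
    (n₀ : ℕ) (hn₀ : 1 ≤ n₀)
    (hlt : (∏ j ∈ Finset.range n₀, Nat.nth (fun q => q.Prime ∧ kron D q = -1) j) < d)
    (hgt : d < ∏ j ∈ Finset.range (n₀ + 1), Nat.nth (fun q => q.Prime ∧ kron D q = -1) j) :
    Nat.nth (fun q => q.Prime ∧ kron D q = -1) n₀ < d := by
  classical
  set P : ℕ → Prop := fun q => q.Prime ∧ kron D q = -1 with hP
  by_contra! hle
  have hD0 : D ≠ 0 := by rintro rfl; exact hns ⟨0, rfl⟩
  have hD1 : D ≠ 1 := by rintro rfl; exact hns ⟨1, rfl⟩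
  have hD4 : D ≠ 4 := by rintro rfl; exact hns ⟨2, rfl⟩
  have hd4 : 4 < d := by omega
  set N := ∏ j ∈ Finset.range n₀, Nat.nth P j with hN
  have hN0 : 0 < N := Nat.pos_of_ne_zero fun h => by
    rw [Finset.prod_range_succ, ← hN, h, zero_mul] at hgt
    omega
  have hdvdN : ∀ j < n₀, Nat.nth P j ∣ N := fun j hj =>
    Finset.dvd_prod_of_mem _ (Finset.mem_range.2 hj)
  obtain ⟨χ, hmul, hper, h1, htri, hzero, hkron⟩ := exists_periodic_mul_eq_kron D hD hD0
  rw [← hd] at hper hzero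
  set Q := ∏ p ∈ (Finset.range d).filter P, p with hQdef
  have hprime : ∀ p ∈ (Finset.range d).filter P, Prime p := fun p hp =>
    (Finset.mem_filter.1 hp).2.1.prime
  have hQN : Q ∣ N := by
    refine Finset.prod_primes_dvd N hprime fun p hp => ?_
    obtain ⟨hpd, hpP⟩ := Finset.mem_filter.1 hp
    obtain ⟨j, hj, rfl⟩ :=
      Nat.exists_lt_nth_eq_of_lt_nth hpP ((Finset.mem_range.1 hpd).trans_le hle)
    exact hdvdN j hj
  have hQd : Q < d := (Nat.le_of_dvd hN0 hQN).trans_lt hlt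
  have hQ : ∀ p : ℕ, p.Prime → (p ∣ Q ↔ (p : ℤ) < d ∧ χ p = -1) := by
    intro p hp
    rw [hkron p hp, Nat.cast_lt]
    constructor
    · intro h
      obtain ⟨q, hq, hpq⟩ := (hp.prime.dvd_finsetProd_iff _).1 h
      obtain ⟨hqd, hqP⟩ := Finset.mem_filter.1 hq
      rw [(Nat.prime_dvd_prime_iff_eq hp hqP.1).1 hpq]
      exact ⟨Finset.mem_range.1 hqd, hqP.2⟩
    · rintro ⟨h, h'⟩
      exact Finset.dvd_prod_of_mem _ (Finset.mem_filter.2 ⟨Finset.mem_range.2 h, hp, h'⟩)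
  have hsq : Squarefree Q := by
    refine Finset.squarefree_prod_of_pairwise_isCoprime (fun p hp q hq hpq => ?_)
      fun p hp => (hprime p hp).squarefree
    exact Nat.coprime_iff_isRelPrime.1
      ((Nat.coprime_primes (hprime p hp).nat_prime (hprime q hq).nat_prime).2 hpq)
  have hQ1 : 1 < Q := by
    have h0 : P (Nat.nth P 0) := Nat.nth_mem_of_ne_zero fun h => by
      have := hdvdN 0 hn₀
      rw [h, zero_dvd_iff] at this
      omega
    have hlt0 : Nat.nth P 0 < d := (Nat.le_of_dvd hN0 (hdvdN 0 hn₀)).trans_lt hlt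
    have hdvd : Nat.nth P 0 ∣ Q :=
      Finset.dvd_prod_of_mem _ (Finset.mem_filter.2 ⟨Finset.mem_range.2 hlt0, h0⟩)
    exact h0.1.one_lt.trans_le (Nat.le_of_dvd (Nat.pos_of_ne_zero hsq.ne_zero) hdvd)
  exact false_of_squarefree_lt χ d Q hmul hper h1 htri hzero (by omega) (by omega) hQ1
    (by omega) hsq hQ
end

section
/- Let D ≡ 0 or 1 (mod 4) be a non-square integer with D ∉ {-3, -4, 5}, d = |D|, and let q₁ < q₂ < ⋯ be all primes q with Kronecker symbol (D/q) = -1. Let i₀ be the index such that q_{i₀+1} is the least such prime exceeding d. Then for all i ≥ i₀, the inequality q_{i+1} < q₁q₂⋯q_i holds. -/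
/-- The properties of the Kronecker character `(D/·)` used in the search for small nonresidues:
here `d = |D|`, and `s` is the sign of `D`. -/
structure IsKroneckerCharacter (f : ℤ →* ℤ) (d s : ℤ) : Prop where
  seven_le : 7 ≤ d
  sign : s = 1 ∨ s = -1
  map_add_period : ∀ a, f (a + d) = f a
  map_neg : ∀ a, f (-a) = s * f a
  isCoprime : ∀ a, f a ≠ 0 → IsCoprime a d
  at_two : f 2 = 1 ∨ (f 2 = -1 ∧ (s = 1 → d % 8 = 5) ∧ (s = -1 → d % 8 = 3)) ∨
    ∃ h σ : ℤ, d = 2 * h ∧ 2 ∣ h ∧ (σ = 1 ∨ σ = -1) ∧ ∀ a, f (a + h) = σ * f a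

/-- `n` is a nonresidue coprime to `N` and less than `N` or less than the period `d`. -/
structure IsSmallNonresidue (f : ℤ →* ℤ) (d N n : ℤ) : Prop where
  pos : 0 < n
  lt : n < max N d
  isCoprime : IsCoprime n N
  map_eq : f n = -1

theorem isCoprime_mul_add {u M v d : ℤ} (hv : IsCoprime v M) (hd : IsCoprime M d) :
    IsCoprime (u * M + v * d) M := by
  have h := (hv.mul_left hd.symm).add_mul_left_left u
  rwa [show v * d + M * u = u * M + v * d by ring] at h

namespace IsKroneckerCharacter

variable {f : ℤ →* ℤ} {d s : ℤ}

theorem map_add_mul (hf : IsKroneckerCharacter f d s) (a k : ℤ) : f (a + k * d) = f a := by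
  induction k using Int.induction_on with
  | zero => simp
  | succ k ih => rw [← ih, ← hf.map_add_period (a + k * d)]; congr 1; ring
  | pred k ih => rw [← ih, ← hf.map_add_period (a + (-k - 1) * d)]; congr 1; ring

theorem map_mul_add_mul (hf : IsKroneckerCharacter f d s) (u M v : ℤ) :
    f (u * M + v * d) = f u * f M := by
  rw [hf.map_add_mul, map_mul]

theorem map_abs (hf : IsKroneckerCharacter f d 1) (a : ℤ) : f |a| = f a := by
  rcases abs_choice a with h | h <;> rw [h]
  rw [hf.map_neg, one_mul]

theorem not_dvd (hf : IsKroneckerCharacter f d s) {p : ℤ} (hp : Prime p)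
    (h : f p = -1) : ¬ p ∣ d := by
  rw [← hp.coprime_iff_not_dvd]
  exact hf.isCoprime p (by rw [h]; norm_num)

theorem ne_zero (hf : IsKroneckerCharacter f d s) {z : ℤ} (hz : f z = -1) : z ≠ 0 := by
  rintro rfl
  have h0 := hf.isCoprime 0 (by rw [hz]; norm_num)
  rw [isCoprime_zero_left, Int.isUnit_iff] at h0
  have := hf.seven_le
  omega

theorem isSmallNonresidue_abs (hf : IsKroneckerCharacter f d s) {N z : ℤ}
    (hz : IsCoprime z N) (hlt : |z| < max N d) (hfz : f |z| = -1) :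
    IsSmallNonresidue f d N |z| :=
  ⟨abs_pos.2 fun h => hf.ne_zero hfz (by rw [h, abs_zero]), hlt, hz.abs_left, hfz⟩

theorem isSmallNonresidue (hf : IsKroneckerCharacter f d s) {N z : ℤ} (h0 : 0 ≤ z)
    (hz : IsCoprime z N) (hlt : z < max N d) (hfz : f z = -1) :
    IsSmallNonresidue f d N z :=
  ⟨lt_of_le_of_ne h0 (hf.ne_zero hfz).symm, hlt, hz, hfz⟩

/-- Of two nonresidues coprime to `M`, one is coprime to `M * p` unless `p` divides both. -/
theorem exists_of_pair (hf : IsKroneckerCharacter f d s) {M p x y : ℤ} (hp : Prime p)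
    (hx : IsCoprime x M) (hy : IsCoprime y M)
    (hlx : |x| < max (M * p) d) (hly : |y| < max (M * p) d)
    (hfx : f |x| = -1) (hfy : f |y| = -1) (hxy : ¬ (p ∣ x ∧ p ∣ y)) :
    ∃ n, IsSmallNonresidue f d (M * p) n := by
  by_cases h : p ∣ x
  · exact ⟨_, hf.isSmallNonresidue_abs
      (hy.mul_right (hp.coprime_iff_not_dvd.2 fun h' => hxy ⟨h, h'⟩).symm) hly hfy⟩
  · exact ⟨_, hf.isSmallNonresidue_abs
      (hx.mul_right (hp.coprime_iff_not_dvd.2 h).symm) hlx hfx⟩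

theorem abs_sub_lt_max {a b N d : ℤ} (ha : 0 < a) (hb : 0 < b) (haN : a ≤ N) (hbd : b ≤ d) :
    |a - b| < max N d := by
  rw [lt_max_iff, abs_lt, abs_lt]
  omega

/-- The case of a positive discriminant and an even number of primes. -/
theorem exists_of_pos_of_even (hf : IsKroneckerCharacter f d 1) {M p : ℤ} (hM : 0 < M)
    (hp0 : 0 < p) (hp : Prime p) (hpM : ¬ p ∣ M) (hMd : IsCoprime M d) (hfM : f M = -1)
    (hfp : f p = -1) (hlast : f 2 = -1 → 5 ≤ p ∨ M * p = 6) :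
    ∃ n, IsSmallNonresidue f d (M * p) n := by
  have hd := hf.seven_le
  have hp2 : 2 ≤ p := by
    rcases (show p = 1 ∨ 2 ≤ p by omega) with rfl | h
    · exact absurd hp not_prime_one
    · exact h
  have h2M : 2 * M ≤ M * p := by nlinarith
  have hpd := hf.not_dvd hp hfp
  have h1M : IsCoprime (-1 : ℤ) M := isCoprime_one_left.neg_left
  have hNd : IsCoprime (M * p) d := hMd.mul_left (hp.coprime_iff_not_dvd.2 hpd)
  have hc (u : ℤ) : IsCoprime (u * M - d) M := by
    have := isCoprime_mul_add (u := u) h1M hMd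
    rwa [show u * M + -1 * d = u * M - d by ring] at this
  have hv (u : ℤ) (hu : f u = 1) : f |u * M - d| = -1 := by
    have := hf.map_mul_add_mul u M (-1)
    rw [show u * M + -1 * d = u * M - d by ring] at this
    rw [hf.map_abs, this, hu, hfM]; norm_num
  rcases hf.at_two with h2 | ⟨h2, h5, -⟩ | ⟨h, σ, rfl, -, hσ, hper⟩
  · refine hf.exists_of_pair hp (hc 1) (hc 2) ?_ ?_ (hv 1 f.map_one) (hv 2 h2) ?_
    · exact abs_sub_lt_max (by omega) (by omega) (by omega) le_rfl
    · exact abs_sub_lt_max (by omega) (by omega) (by omega) le_rfl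
    · rintro ⟨ha, hb⟩
      have := dvd_sub hb ha
      rw [show 2 * M - d - (1 * M - d) = M by ring] at this
      exact hpM this
  · have h4 : f 4 = 1 := by rw [show (4 : ℤ) = 2 * 2 by norm_num, map_mul, h2]; norm_num
    rcases hlast h2 with h5p | h6
    · refine hf.exists_of_pair hp (hc 1) (hc 4) ?_ ?_ (hv 1 f.map_one) (hv 4 h4) ?_
      · exact abs_sub_lt_max (by omega) (by omega) (by omega) le_rfl
      · exact abs_sub_lt_max (by omega) (by omega) (by nlinarith) le_rfl
      · rintro ⟨ha, hb⟩
        have h3 := dvd_sub hb ha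
        rw [show 4 * M - d - (1 * M - d) = 3 * M by ring] at h3
        rcases hp.dvd_or_dvd h3 with h3 | h3
        · have := Int.le_of_dvd (by norm_num) h3
          omega
        · exact hpM h3
    · have := h5 rfl
      refine ⟨_, hf.isSmallNonresidue (z := d - 12) (by omega) ?_ (by omega) ?_⟩
      · rw [h6] at hNd ⊢
        simpa [show d - 12 = d + 6 * (-2) by ring] using hNd.symm.add_mul_left_left (-2)
      · have h3 : f 3 = -1 := by
          have h6' : f 6 = 1 := by rw [← h6, map_mul, hfM, hfp]; norm_num
          rw [show (6 : ℤ) = 2 * 3 by norm_num, map_mul, h2] at h6'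
          omega
        rw [show d - 12 = -(4 * 3) + d by ring, hf.map_add_period, hf.map_neg, map_mul, h4, h3]
        norm_num
  · have hsub (a : ℤ) : f (a - h) = σ * f a := by
      have := hper (a - h)
      rw [sub_add_cancel] at this
      rcases hσ with rfl | rfl <;> linarith
    rcases hσ with rfl | rfl
    · refine hf.exists_of_pair hp (x := M - h) (by
        simpa [show M - h = -h + M * 1 by ring] using
          hMd.of_mul_right_right.symm.neg_left.add_mul_left_left 1) (hc 1)
        ?_ ?_ (by rw [hf.map_abs, hsub, hfM]; norm_num) (hv 1 f.map_one) ?_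
      · exact abs_sub_lt_max (by omega) (by omega) (by omega) (by omega)
      · exact abs_sub_lt_max (by omega) (by omega) (by omega) le_rfl
      · rintro ⟨ha, hb⟩
        have := dvd_sub ha hb
        rw [show M - h - (1 * M - 2 * h) = h by ring] at this
        exact hpd (this.mul_left 2)
    · refine ⟨_, hf.isSmallNonresidue_abs (z := M * p - h) ?_ ?_ ?_⟩
      · simpa [show M * p - h = -h + M * p * 1 by ring] using
          hNd.of_mul_right_right.symm.neg_left.add_mul_left_left 1
      · exact abs_sub_lt_max (by omega) (by omega) (by omega) (by omega)
      · rw [hf.map_abs, hsub, map_mul, hfM, hfp]; norm_num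

theorem exists_of_odd_of_lt (hf : IsKroneckerCharacter f d s) {N : ℤ} (hNd : IsCoprime N d)
    (hfN : f N = -1) (hlt : d < N) : ∃ n, IsSmallNonresidue f d N n := by
  have hd := hf.seven_le
  have hp := hf.map_add_mul N (-1)
  rw [show N + -1 * d = N - d by ring] at hp
  refine ⟨N - d, hf.isSmallNonresidue (by omega) ?_ (by omega) (hp.trans hfN)⟩
  simpa [show N - d = -d + N * 1 by ring] using hNd.symm.neg_left.add_mul_left_left 1

theorem exists_of_pos_of_odd (hf : IsKroneckerCharacter f d 1) {N : ℤ} (hN : 0 < N)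
    (hNd : IsCoprime N d) (hfN : f N = -1) : ∃ n, IsSmallNonresidue f d N n := by
  have hd := hf.seven_le
  have hp := hf.map_add_mul N (-1)
  rw [show N + -1 * d = N - d by ring] at hp
  refine ⟨_, hf.isSmallNonresidue_abs (z := N - d) ?_
    (abs_sub_lt_max hN (by omega) le_rfl le_rfl) (by rw [hf.map_abs, hp, hfN])⟩
  simpa [show N - d = -d + N * 1 by ring] using hNd.symm.neg_left.add_mul_left_left 1

theorem abs_lt_max {a N d : ℤ} (h0 : 0 ≤ a) (h : a < d) : |a| < max N d := by
  rw [abs_of_nonneg h0]; omega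

/-- The case of a negative discriminant and an odd number of primes with product less than `d`. -/
theorem exists_of_neg_of_odd (hf : IsKroneckerCharacter f d (-1)) {M p : ℤ} (hM : 0 < M)
    (hp0 : 0 < p) (hp : Prime p) (hpM : ¬ p ∣ M) (hMd : IsCoprime M d) (hfM : f M = 1)
    (hfp : f p = -1) (hlast : 5 ≤ p ∨ M = 1) (hlt : M * p < d) :
    ∃ n, IsSmallNonresidue f d (M * p) n := by
  have hd := hf.seven_le
  have hp2 : 2 ≤ p := by
    rcases (show p = 1 ∨ 2 ≤ p by omega) with rfl | h
    · exact absurd hp not_prime_one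
    · exact h
  have h2M : 2 * M ≤ M * p := by nlinarith
  have hpd := hf.not_dvd hp hfp
  have hNd : IsCoprime (M * p) d := hMd.mul_left (hp.coprime_iff_not_dvd.2 hpd)
  have hc (u : ℤ) : IsCoprime (d - u * M) M := by
    have := isCoprime_mul_add (u := -u) (isCoprime_one_left (x := M)) hMd
    rwa [show -u * M + 1 * d = d - u * M by ring] at this
  have hv (u : ℤ) (hu : f u = 1) : f (d - u * M) = -1 := by
    have := hf.map_mul_add_mul (-u) M 1
    rw [show -u * M + 1 * d = d - u * M by ring] at this
    rw [this, hf.map_neg, hu, hfM]; norm_num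
  have hv' (u : ℤ) (h0 : 0 ≤ d - u * M) (hu : f u = 1) : f |d - u * M| = -1 := by
    rw [abs_of_nonneg h0, hv u hu]
  rcases hf.at_two with h2 | ⟨h2, -, h3⟩ | ⟨h, σ, rfl, h2, hσ, hper⟩
  · refine hf.exists_of_pair hp (hc 1) (hc 2) ?_ ?_ (hv' 1 (by omega) f.map_one)
      (hv' 2 (by omega) h2) ?_
    · exact abs_lt_max (by omega) (by omega)
    · exact abs_lt_max (by omega) (by omega)
    · rintro ⟨ha, hb⟩
      have := dvd_sub ha hb
      rw [show d - 1 * M - (d - 2 * M) = M by ring] at this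
      exact hpM this
  · have h4 : f 4 = 1 := by rw [show (4 : ℤ) = 2 * 2 by norm_num, map_mul, h2]; norm_num
    have hd3 := h3 rfl
    by_cases h5p : 5 ≤ p
    · have h5M : 5 * M ≤ M * p := by nlinarith
      refine hf.exists_of_pair hp (hc 1) (hc 4) ?_ ?_ (hv' 1 (by omega) f.map_one)
        (hv' 4 (by omega) h4) ?_
      · exact abs_lt_max (by omega) (by omega)
      · exact abs_lt_max (by omega) (by omega)
      · rintro ⟨ha, hb⟩
        have h3 := dvd_sub ha hb
        rw [show d - 1 * M - (d - 4 * M) = 3 * M by ring] at h3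
        rcases hp.dvd_or_dvd h3 with h3 | h3
        · have := Int.le_of_dvd (by norm_num) h3
          omega
        · exact hpM h3
    · obtain rfl : M = 1 := by tauto
      rw [one_mul] at hNd ⊢
      have h4p : p ≠ 4 := by
        rintro rfl
        omega
      rcases (show p = 2 ∨ p = 3 by omega) with rfl | rfl
      · refine ⟨_, hf.isSmallNonresidue (z := d - 4) (by omega) ?_ (by omega) ?_⟩
        · simpa [show d - 4 = d + 2 * (-2) by ring] using hNd.symm.add_mul_left_left (-2)
        · simpa using hv 4 h4
      · refine ⟨_, hf.isSmallNonresidue (z := d - 9) (by omega) ?_ (by omega) ?_⟩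
        · simpa [show d - 9 = d + 3 * (-3) by ring] using hNd.symm.add_mul_left_left (-3)
        · simpa using hv 9 (by
            rw [show (9 : ℤ) = 3 * 3 by norm_num, map_mul, hfp]; norm_num)
  · have h2p : p ≠ 2 := by
      rintro rfl
      exact hpd (dvd_mul_right 2 h)
    have h3M : 3 * M ≤ M * p := by nlinarith [show 3 ≤ p by omega]
    have hMh : IsCoprime M h := hMd.of_mul_right_right
    rcases hσ with rfl | rfl
    · refine hf.exists_of_pair hp (x := h - M) (by
        simpa [show h - M = h + M * (-1) by ring] using hMh.symm.add_mul_left_left (-1)) (hc 1)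
        ?_ ?_ ?_ (hv' 1 (by omega) f.map_one) ?_
      · exact abs_lt_max (by omega) (by omega)
      · exact abs_lt_max (by omega) (by omega)
      · rw [abs_of_nonneg (by omega), show h - M = -M + h by ring, hper, hf.map_neg, hfM]; norm_num
      · rintro ⟨ha, hb⟩
        have := dvd_sub hb ha
        rw [show 2 * h - 1 * M - (h - M) = h by ring] at this
        exact hpd (this.mul_left 2)
    · by_cases h3p : p = 3
      · obtain rfl : M = 1 := by omega
        subst h3p
        rw [one_mul] at hNd ⊢
        by_cases h9 : 9 < 2 * h
        · refine ⟨_, hf.isSmallNonresidue (z := 2 * h - 9) (by omega) ?_ (by omega) ?_⟩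
          · simpa [show 2 * h - 9 = 2 * h + 3 * (-3) by ring] using hNd.symm.add_mul_left_left (-3)
          · simpa using hv 9 (by
              rw [show (9 : ℤ) = 3 * 3 by norm_num, map_mul, hfp]; norm_num)
        · obtain rfl : h = 4 := by omega
          refine ⟨_, hf.isSmallNonresidue (z := 5) (by omega) ?_ (by omega) ?_⟩
          · exact ⟨-1, 2, by norm_num⟩
          · rw [show (5 : ℤ) = 1 + 4 by norm_num, hper, f.map_one]; norm_num
      · refine hf.exists_of_pair hp (x := M + h) (by
          simpa [show M + h = h + M * 1 by ring] using hMh.symm.add_mul_left_left 1) (hc 1)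
          ?_ ?_ ?_ (hv' 1 (by omega) f.map_one) ?_
        · exact abs_lt_max (by omega) (by omega)
        · exact abs_lt_max (by omega) (by omega)
        · rw [abs_of_nonneg (by omega), hper, hfM]; norm_num
        · rintro ⟨ha, hb⟩
          have := dvd_add ha hb
          rw [show M + h + (2 * h - 1 * M) = 3 * h by ring] at this
          rcases hp.dvd_or_dvd this with h' | h'
          · have := Int.le_of_dvd (by norm_num) h'
            omega
          · exact hpd (h'.mul_left 2)

theorem exists_of_neg_of_even_of_lt (hf : IsKroneckerCharacter f d (-1)) {N : ℤ} (hN : 0 < N)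
    (hNd : IsCoprime N d) (hfN : f N = 1) (hlt : N < d) : ∃ n, IsSmallNonresidue f d N n := by
  refine ⟨d - N, hf.isSmallNonresidue (by omega) ?_ (by omega) ?_⟩
  · simpa [show d - N = d + N * (-1) by ring] using hNd.symm.add_mul_left_left (-1)
  · rw [show d - N = -N + d by ring, hf.map_add_period, hf.map_neg, hfN]; norm_num

/-- For odd `N`, some `2 ^ k * d` lies strictly between `N` and `2 * N`. -/
theorem exists_of_neg_of_not_two_dvd (hf : IsKroneckerCharacter f d (-1)) {N : ℤ}
    (hNd : IsCoprime N d) (hfN : f N = 1) (hlt : d < N) (h2 : ¬ (2 : ℤ) ∣ N) :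
    ∃ n, IsSmallNonresidue f d N n := by
  have hd := hf.seven_le
  have hex : ∃ k : ℕ, N < 2 ^ k * d := by
    refine ⟨N.toNat, ?_⟩
    have h1 : (N.toNat : ℤ) < 2 ^ N.toNat := by exact_mod_cast Nat.lt_two_pow_self
    have h3 : (0 : ℤ) < 2 ^ N.toNat := by positivity
    nlinarith [Int.self_le_toNat N]
  classical
  obtain ⟨k, hk, hmin⟩ : ∃ k : ℕ, N < 2 ^ k * d ∧ ∀ j < k, 2 ^ j * d ≤ N :=
    ⟨Nat.find hex, Nat.find_spec hex, fun j hj => not_lt.1 (Nat.find_min hex hj)⟩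
  have h2N : IsCoprime ((2 : ℤ) ^ k) N := (Int.prime_two.coprime_iff_not_dvd.2 h2).pow_left
  have hfn : f (2 ^ k * d - N) = -1 := by
    rw [show 2 ^ k * d - N = -N + 2 ^ k * d by ring, hf.map_add_mul, hf.map_neg, hfN]; norm_num
  have hcop : IsCoprime (2 ^ k * d - N) N := by
    simpa [show 2 ^ k * d - N = 2 ^ k * d + N * (-1) by ring] using
      (h2N.mul_left hNd.symm).add_mul_left_left (-1)
  cases k with
  | zero => simp at hk; omega
  | succ k =>
    have hle := hmin k k.lt_succ_self
    rw [pow_succ] at *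
    refine ⟨_, hf.isSmallNonresidue (by omega) hcop (lt_max_of_lt_left ?_) hfn⟩
    have hne : 2 ^ k * 2 * d - N ≠ N := by
      intro h
      rw [h, isCoprime_self, Int.isUnit_iff] at hcop
      omega
    have : 2 ^ k * 2 * d = 2 * (2 ^ k * d) := by ring
    omega

theorem exists_of_neg_of_two_mul (hf : IsKroneckerCharacter f d (-1)) {M : ℤ}
    (hMd : IsCoprime M d) (h2M : ¬ (2 : ℤ) ∣ M) (hfM : f M = -1) (hlt : 4 * d < 2 * M) :
    ∃ n, IsSmallNonresidue f d (2 * M) n := by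
  have hd := hf.seven_le
  have h2 : IsCoprime (2 : ℤ) M := Int.prime_two.coprime_iff_not_dvd.2 h2M
  refine ⟨M - 2 * d, hf.isSmallNonresidue (by omega) ?_ (by omega) ?_⟩
  · refine IsCoprime.mul_right ?_ ?_
    · simpa [show M - 2 * d = M + 2 * (-d) by ring] using h2.symm.add_mul_left_left (-d)
    · simpa [show M - 2 * d = -(2 * d) + M * 1 by ring] using
        (h2.mul_left hMd.symm).neg_left.add_mul_left_left 1
  · rw [show M - 2 * d = M + (-2) * d by ring, hf.map_add_mul, hfM]

theorem exists_of_neg_of_two_mul_prime (hf : IsKroneckerCharacter f d (-1)) {p : ℤ} (hp0 : 0 < p)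
    (hp : Prime p) (hp2 : ¬ p ∣ 2) (h2 : f 2 = -1) (hd3 : d % 8 = 3) (hlt : d < 2 * p) :
    ∃ n, IsSmallNonresidue f d (2 * p) n := by
  have hd := hf.seven_le
  have h4 : f 4 = 1 := by rw [show (4 : ℤ) = 2 * 2 by norm_num, map_mul, h2]; norm_num
  have h2d : IsCoprime d 2 := (hf.isCoprime 2 (by rw [h2]; norm_num)).symm
  have hc (k : ℤ) : IsCoprime (d - 2 * k) 2 := by
    simpa [show d - 2 * k = d + 2 * (-k) by ring] using h2d.add_mul_left_left (-k)
  have hv (u : ℤ) (hu : f u = 1) : f (d - u) = -1 := by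
    rw [show d - u = -u + d by ring, hf.map_add_period, hf.map_neg, hu]; norm_num
  by_cases hd11 : d = 11
  · subst hd11
    by_cases h7 : p ∣ 7
    · have hp7 : p = 7 := by
        have := Int.le_of_dvd (by norm_num) h7
        obtain rfl | rfl : p = 6 ∨ p = 7 := by omega
        · norm_num at h7
        · rfl
      subst hp7
      refine ⟨13, hf.isSmallNonresidue (by norm_num) ⟨-1, 1, by norm_num⟩ (by norm_num) ?_⟩
      rw [show (13 : ℤ) = 2 + 11 by norm_num, hf.map_add_period, h2]
    · refine ⟨7, hf.isSmallNonresidue (by norm_num) ?_ (by norm_num) ?_⟩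
      · exact (show IsCoprime (7 : ℤ) 2 from ⟨1, -3, by norm_num⟩).mul_right
          (hp.coprime_iff_not_dvd.2 h7).symm
      · simpa using hv 4 h4
  · have h16 : f 16 = 1 := by rw [show (16 : ℤ) = 4 * 4 by norm_num, map_mul, h4]; norm_num
    refine hf.exists_of_pair hp (x := d - 4) (y := d - 16) (hc 2) (hc 8)
      (abs_lt_max (by omega) (by omega)) (abs_lt_max (by omega) (by omega))
      (by rw [abs_of_nonneg (by omega), hv 4 h4]) (by rw [abs_of_nonneg (by omega), hv 16 h16]) ?_
    rintro ⟨ha, hb⟩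
    have h12 := dvd_sub ha hb
    rw [show d - 4 - (d - 16) = 2 * (2 * 3) by ring] at h12
    rcases hp.dvd_or_dvd h12 with h | h
    · exact hp2 h
    rcases hp.dvd_or_dvd h with h | h
    · exact hp2 h
    · have := Int.le_of_dvd (by norm_num) h
      omega

theorem exists_or_dvd_or_dvd (hf : IsKroneckerCharacter f d s) {M p q n : ℤ} (hp : Prime p)
    (hq : Prime q) (hn : IsCoprime n M) (h0 : 0 ≤ n) (hlt : n < d) (hfn : f n = -1) :
    (∃ n, IsSmallNonresidue f d (M * p * q) n) ∨ p ∣ n ∨ q ∣ n := by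
  by_cases hpn : p ∣ n
  · exact Or.inr (Or.inl hpn)
  by_cases hqn : q ∣ n
  · exact Or.inr (Or.inr hqn)
  exact Or.inl ⟨n, hf.isSmallNonresidue h0 ((hn.mul_right
    (hp.coprime_iff_not_dvd.2 hpn).symm).mul_right (hq.coprime_iff_not_dvd.2 hqn).symm)
    (by omega) hfn⟩

theorem exists_of_neg_of_seven_le (hf : IsKroneckerCharacter f d (-1)) {M p q : ℤ} (hM : 0 < M)
    (hp : Prime p) (hq : Prime q) (hpM : ¬ p ∣ M) (hqM : ¬ q ∣ M) (hp7 : 7 ≤ p) (hpq : p < q)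
    (hMd : IsCoprime M d) (hfM : f M = 1) (h2 : f 2 = -1) (hlt : M * p * q < 4 * d) :
    ∃ n, IsSmallNonresidue f d (M * p * q) n := by
  have h4 : f 4 = 1 := by rw [show (4 : ℤ) = 2 * 2 by norm_num, map_mul, h2]; norm_num
  have h16 : f 16 = 1 := by rw [show (16 : ℤ) = 4 * 4 by norm_num, map_mul, h4]; norm_num
  have hq11 : 11 ≤ q := by
    by_contra! h
    obtain rfl | rfl | rfl : q = 8 ∨ q = 9 ∨ q = 10 := by omega
    all_goals
      rw [Int.prime_iff_natAbs_prime] at hq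
      norm_num at hq
  have hpq77 : 77 ≤ p * q := by nlinarith
  have hM16 : 16 * M < d := by nlinarith
  have hc (u : ℤ) : IsCoprime (d - u * M) M := by
    have := isCoprime_mul_add (u := -u) (isCoprime_one_left (x := M)) hMd
    rwa [show -u * M + 1 * d = d - u * M by ring] at this
  have hv (u : ℤ) (hu : f u = 1) : f (d - u * M) = -1 := by
    have := hf.map_mul_add_mul (-u) M 1
    rw [show -u * M + 1 * d = d - u * M by ring] at this
    rw [this, hf.map_neg, hu, hfM]; norm_num
  have hnd {r c : ℤ} (hr : Prime r) (hr7 : 7 ≤ r) (hrM : ¬ r ∣ M) (hc0 : c = 3 ∨ c = 12 ∨ c = 15) :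
      ¬ r ∣ c * M := by
    have hsmall {x : ℤ} (hx : 0 < x) (hx7 : x < 7) : ¬ r ∣ x := fun h => by
      have := Int.le_of_dvd hx h
      omega
    intro h
    rcases hr.dvd_or_dvd h with h | h
    · rcases hc0 with rfl | rfl | rfl
      · exact hsmall (by norm_num) (by norm_num) h
      · rw [show (12 : ℤ) = 3 * 4 by norm_num] at h
        rcases hr.dvd_or_dvd h with h | h
        · exact hsmall (by norm_num) (by norm_num) h
        · exact hsmall (by norm_num) (by norm_num) h
      · rw [show (15 : ℤ) = 3 * 5 by norm_num] at h
        rcases hr.dvd_or_dvd h with h | h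
        · exact hsmall (by norm_num) (by norm_num) h
        · exact hsmall (by norm_num) (by norm_num) h
    · exact hrM h
  have hall {r : ℤ} (hr : Prime r) (hr7 : 7 ≤ r) (hrM : ¬ r ∣ M) :
      ¬ (r ∣ d - 1 * M ∧ r ∣ d - 4 * M) ∧ ¬ (r ∣ d - 1 * M ∧ r ∣ d - 16 * M) ∧
        ¬ (r ∣ d - 4 * M ∧ r ∣ d - 16 * M) := by
    refine ⟨fun h => hnd hr hr7 hrM (c := 3) (by simp) ?_,
      fun h => hnd hr hr7 hrM (c := 15) (by simp) ?_, fun h => hnd hr hr7 hrM (c := 12) (by simp) ?_⟩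
    all_goals
      have h' := dvd_sub h.1 h.2
      rw [sub_sub_sub_cancel_left, ← sub_mul] at h'
      norm_num at h'
      exact h'
  have hP := hall hp hp7 hpM
  have hQ := hall hq (by omega) hqM
  rcases hf.exists_or_dvd_or_dvd hp hq (hc 1) (by omega) (by omega) (hv 1 f.map_one) with h | ha
  · exact h
  rcases hf.exists_or_dvd_or_dvd hp hq (hc 4) (by omega) (by omega) (hv 4 h4) with h | hb
  · exact h
  rcases hf.exists_or_dvd_or_dvd hp hq (hc 16) (by omega) (by omega) (hv 16 h16) with h | he
  · exact h
  tauto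

theorem exists_of_neg_of_six_mul_five (hf : IsKroneckerCharacter f d (-1)) {p : ℤ} (hp : Prime p)
    (hp7 : 7 ≤ p) (h2 : f 2 = -1) (h3 : f 3 = -1) (hd3 : d % 8 = 3) (hlt : 6 * 5 * p < 4 * d) :
    ∃ n, IsSmallNonresidue f d (6 * 5 * p) n := by
  have hd : 59 ≤ d := by omega
  have h4 : f 4 = 1 := by rw [show (4 : ℤ) = 2 * 2 by norm_num, map_mul, h2]; norm_num
  have h6 : f 6 = 1 := by rw [show (6 : ℤ) = 2 * 3 by norm_num, map_mul, h2, h3]; norm_num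
  have h9 : f 9 = 1 := by rw [show (9 : ℤ) = 3 * 3 by norm_num, map_mul, h3]; norm_num
  have hMd : IsCoprime 6 d := hf.isCoprime 6 (by rw [h6]; norm_num)
  have h5 : Prime (5 : ℤ) := by norm_num
  have hc (u : ℤ) : IsCoprime (d - u * 6) 6 := by
    have := isCoprime_mul_add (u := -u) (isCoprime_one_left (x := 6)) hMd
    rwa [show -u * 6 + 1 * d = d - u * 6 by ring] at this
  have hv (u : ℤ) (hu : f u = 1) : f (d - u * 6) = -1 := by
    have := hf.map_mul_add_mul (-u) 6 1
    rw [show -u * 6 + 1 * d = d - u * 6 by ring] at this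
    rw [this, hf.map_neg, hu, h6]; norm_num
  have h30 : ¬ p ∣ 30 := by
    rw [show (30 : ℤ) = 5 * 6 by norm_num]
    intro h
    rcases hp.dvd_or_dvd h with h | h
    · have := Int.le_of_dvd (by norm_num) h
      omega
    · have := Int.le_of_dvd (by norm_num) h
      omega
  have ha' : ¬ (p ∣ d - 4 * 6 ∧ p ∣ d - 9 * 6) := fun h => h30 (by
    simpa [sub_sub_sub_cancel_left] using dvd_sub h.1 h.2)
  have hb' : ¬ (p ∣ d - 1 * 6 ∧ p ∣ d - 6 * 6) := fun h => h30 (by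
    simpa [sub_sub_sub_cancel_left] using dvd_sub h.1 h.2)
  rcases hf.exists_or_dvd_or_dvd h5 hp (hc 1) (by omega) (by omega) (hv 1 f.map_one) with h | h1
  · exact h
  rcases hf.exists_or_dvd_or_dvd h5 hp (hc 4) (by omega) (by omega) (hv 4 h4) with h | h4
  · exact h
  rcases hf.exists_or_dvd_or_dvd h5 hp (hc 6) (by omega) (by omega) (hv 6 h6) with h | h6
  · exact h
  rcases hf.exists_or_dvd_or_dvd h5 hp (hc 9) (by omega) (by omega) (hv 9 h9) with h | h9
  · exact h
  have e1 : (5 : ℤ) ∣ d - 1 * 6 → ¬ (5 : ℤ) ∣ d - 4 * 6 := by omega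
  have e2 : (5 : ℤ) ∣ d - 1 * 6 → ¬ (5 : ℤ) ∣ d - 9 * 6 := by omega
  have e3 : (5 : ℤ) ∣ d - 6 * 6 → ¬ (5 : ℤ) ∣ d - 4 * 6 := by omega
  have e4 : (5 : ℤ) ∣ d - 6 * 6 → ¬ (5 : ℤ) ∣ d - 9 * 6 := by omega
  rcases h1 with h1 | h1
  · exact absurd ⟨h4.resolve_left (e1 h1), h9.resolve_left (e2 h1)⟩ ha'
  · have h6 := h6.resolve_right fun h => hb' ⟨h1, h⟩
    exact absurd ⟨h4.resolve_left (e3 h6), h9.resolve_left (e4 h6)⟩ ha'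

section Finset

variable {Q : Finset ℕ}

theorem map_prod_eq (hQ : ∀ q ∈ Q, q.Prime ∧ f q = -1) :
    f (∏ q ∈ Q, (q : ℤ)) = (-1) ^ Q.card := by
  rw [map_prod, Finset.prod_congr rfl fun q hq => (hQ q hq).2, Finset.prod_const]

theorem isCoprime_prod (hf : IsKroneckerCharacter f d s) (hQ : ∀ q ∈ Q, q.Prime ∧ f q = -1) :
    IsCoprime (∏ q ∈ Q, (q : ℤ)) d :=
  hf.isCoprime _ (by rw [map_prod_eq hQ]; exact pow_ne_zero _ (by norm_num))

theorem not_dvd_prod (hQ : ∀ q ∈ Q, q.Prime ∧ f q = -1) {p : ℕ} (hp : p.Prime) (hpQ : p ∉ Q) :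
    ¬ (p : ℤ) ∣ ∏ q ∈ Q, (q : ℤ) := by
  intro h
  obtain ⟨q, hq, hpq⟩ := (Nat.prime_iff_prime_int.1 hp).exists_mem_finset_dvd h
  rw [Int.natCast_dvd_natCast, Nat.prime_dvd_prime_iff_eq hp (hQ q hq).1] at hpq
  exact hpQ (hpq ▸ hq)

theorem prod_pos_of_prime (hQ : ∀ q ∈ Q, q.Prime ∧ f q = -1) : 0 < ∏ q ∈ Q, (q : ℤ) :=
  Finset.prod_pos fun q hq => by exact_mod_cast (hQ q hq).1.pos

theorem prime_of_mem (hQ : ∀ q ∈ Q, q.Prime ∧ f q = -1) {p : ℕ} (hp : p ∈ Q) : Prime (p : ℤ) :=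
  Nat.prime_iff_prime_int.1 (hQ p hp).1

theorem exists_of_neg_of_even (hf : IsKroneckerCharacter f d (-1)) (hne : Q.Nonempty)
    (hQ : ∀ q ∈ Q, q.Prime ∧ f q = -1) (heven : Even Q.card) :
    ∃ n, IsSmallNonresidue f d (∏ q ∈ Q, (q : ℤ)) n := by
  have hd := hf.seven_le
  have hcard := hne.card_pos
  have hNd := hf.isCoprime_prod hQ
  have hN := prod_pos_of_prime hQ
  have hfN := map_prod_eq hQ
  rw [heven.neg_one_pow] at hfN
  have hErase (p : ℕ) {R : Finset ℕ} (hR : ∀ q ∈ R, q.Prime ∧ f q = -1) :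
      ∀ q ∈ R.erase p, q.Prime ∧ f q = -1 := fun q hq => hR q (Finset.mem_of_mem_erase hq)
  by_cases hlt : ∏ q ∈ Q, (q : ℤ) < d
  · exact hf.exists_of_neg_of_even_of_lt hN hNd hfN hlt
  have hne_mul (k : ℤ) : ∏ q ∈ Q, (q : ℤ) ≠ k * d := by
    intro h
    rw [h] at hNd
    have h' := hNd.of_mul_left_right
    rw [isCoprime_self, Int.isUnit_iff] at h'
    omega
  have hgt : d < ∏ q ∈ Q, (q : ℤ) := by
    have := hne_mul 1
    omega
  by_cases h2N : (2 : ℤ) ∣ ∏ q ∈ Q, (q : ℤ)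
  swap
  · exact hf.exists_of_neg_of_not_two_dvd hNd hfN hgt h2N
  have h2Q : 2 ∈ Q := by
    by_contra h
    exact not_dvd_prod hQ Nat.prime_two h h2N
  have h2 : f 2 = -1 := (hQ 2 h2Q).2
  have hd3 : d % 8 = 3 := by
    rcases hf.at_two with h | ⟨-, -, h⟩ | ⟨h, -, rfl, -⟩
    · omega
    · exact h rfl
    · exact absurd (dvd_mul_right 2 h) (hf.not_dvd Int.prime_two h2)
  have hprod2 : 2 * ∏ q ∈ Q.erase 2, (q : ℤ) = ∏ q ∈ Q, (q : ℤ) :=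
    Finset.mul_prod_erase Q (fun q : ℕ => (q : ℤ)) h2Q
  have hR := hErase 2 hQ
  have h2R : ¬ (2 : ℤ) ∣ ∏ q ∈ Q.erase 2, (q : ℤ) :=
    not_dvd_prod hR Nat.prime_two (Finset.notMem_erase 2 Q)
  by_cases hgt4 : 4 * d < ∏ q ∈ Q, (q : ℤ)
  · rw [← hprod2] at hgt4 ⊢
    refine hf.exists_of_neg_of_two_mul (hf.isCoprime_prod hR) h2R ?_ hgt4
    rw [← hprod2, map_mul, h2] at hfN
    omega
  have hlt4 : ∏ q ∈ Q, (q : ℤ) < 4 * d := by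
    have := hne_mul 4
    omega
  by_cases hc2 : Q.card = 2
  · have hR1 : (Q.erase 2).card = 1 := by rw [Finset.card_erase_of_mem h2Q, hc2]
    obtain ⟨p, hp⟩ := Finset.card_eq_one.1 hR1
    have hpR : p ∈ Q.erase 2 := by simp [hp]
    rw [← hprod2, hp, Finset.prod_singleton] at hgt ⊢
    have hpp := (hR p hpR).1
    refine hf.exists_of_neg_of_two_mul_prime (by exact_mod_cast hpp.pos) (prime_of_mem hR hpR) ?_
      h2 hd3 hgt
    intro h
    have h' : p ∣ 2 := by exact_mod_cast h
    exact (Finset.ne_of_mem_erase hpR) ((Nat.prime_dvd_prime_iff_eq hpp Nat.prime_two).1 h')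
  have hc4 : 4 ≤ Q.card := by
    obtain ⟨r, hr⟩ := heven
    omega
  by_cases hT : 1 < (Q.filter (7 ≤ ·)).card
  · obtain ⟨p, hp, q, hq, hpq⟩ : ∃ p ∈ Q.filter (7 ≤ ·), ∃ q ∈ Q.filter (7 ≤ ·), p < q := by
      obtain ⟨a, ha, b, hb, hab⟩ := Finset.one_lt_card.1 hT
      rcases lt_or_gt_of_ne hab with h | h
      · exact ⟨a, ha, b, hb, h⟩
      · exact ⟨b, hb, a, ha, h⟩
    rw [Finset.mem_filter] at hp hq
    have hpq' : p ∈ Q.erase q := Finset.mem_erase.2 ⟨hpq.ne, hp.1⟩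
    have hprod : (∏ r ∈ (Q.erase q).erase p, (r : ℤ)) * p * q = ∏ r ∈ Q, (r : ℤ) := by
      rw [Finset.prod_erase_mul _ (fun r : ℕ => (r : ℤ)) hpq',
        Finset.prod_erase_mul _ (fun r : ℕ => (r : ℤ)) hq.1]
    have hM := hErase p (hErase q hQ)
    rw [← hprod] at hlt4 hfN ⊢
    refine hf.exists_of_neg_of_seven_le (prod_pos_of_prime hM) (prime_of_mem hQ hp.1)
      (prime_of_mem hQ hq.1) (not_dvd_prod hM (hQ p hp.1).1 (Finset.notMem_erase _ _))
      (not_dvd_prod hM (hQ q hq.1).1 fun h => Finset.notMem_erase q Q (Finset.mem_of_mem_erase h))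
      (by exact_mod_cast hp.2) (by exact_mod_cast hpq) (hf.isCoprime_prod hM) ?_ h2 hlt4
    rw [map_mul, map_mul, (hQ p hp.1).2, (hQ q hq.1).2] at hfN
    omega
  · have hsub : Q ⊆ {2, 3, 5} ∪ Q.filter (7 ≤ ·) := by
      intro q hq
      have hqp := (hQ q hq).1
      by_cases h7 : 7 ≤ q
      · exact Finset.mem_union_right _ (Finset.mem_filter.2 ⟨hq, h7⟩)
      · refine Finset.mem_union_left _ ?_
        have := hqp.two_le
        interval_cases q <;> first | decide | (revert hqp; decide)
    have hle := Finset.card_le_card hsub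
    have hun := Finset.card_union_le {2, 3, 5} (Q.filter (7 ≤ ·))
    have h3 : ({2, 3, 5} : Finset ℕ).card = 3 := by decide
    obtain ⟨p, hp⟩ := Finset.card_eq_one.1 (show (Q.filter (7 ≤ ·)).card = 1 by omega)
    have hpT : p ∈ Q.filter (7 ≤ ·) := by simp [hp]
    rw [Finset.mem_filter] at hpT
    have hQeq : Q = {2, 3, 5} ∪ {p} := by
      rw [← hp]
      exact Finset.eq_of_subset_of_card_le hsub (by omega)
    have hprod : ∏ q ∈ Q, (q : ℤ) = 6 * 5 * p := by
      rw [hQeq, Finset.prod_union (by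
        rw [Finset.disjoint_singleton_right]
        simp only [Finset.mem_insert, Finset.mem_singleton]
        omega)]
      simp
    rw [hprod] at hlt4 ⊢
    exact hf.exists_of_neg_of_six_mul_five (prime_of_mem hQ hpT.1) (by exact_mod_cast hpT.2) h2
      (hQ 3 (by rw [hQeq]; simp)).2 hd3 hlt4

/-- Any nonempty finite set of primes `q` with `f q = -1` and product `N` admits a nonresidue
coprime to `N` and less than `max N d`. -/
theorem exists_isSmallNonresidue (hf : IsKroneckerCharacter f d s) (hne : Q.Nonempty)
    (hQ : ∀ q ∈ Q, q.Prime ∧ f q = -1) :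
    ∃ n, IsSmallNonresidue f d (∏ q ∈ Q, (q : ℤ)) n := by
  have hN := prod_pos_of_prime hQ
  have hNd := hf.isCoprime_prod hQ
  have hfN := map_prod_eq hQ
  set p := Q.max' hne with hpdef
  have hpQ : p ∈ Q := Q.max'_mem hne
  have hM : ∀ q ∈ Q.erase p, q.Prime ∧ f q = -1 := fun q hq => hQ q (Finset.mem_of_mem_erase hq)
  have hprod : (∏ q ∈ Q.erase p, (q : ℤ)) * p = ∏ q ∈ Q, (q : ℤ) :=
    Finset.prod_erase_mul _ (fun q : ℕ => (q : ℤ)) hpQ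
  have hsub : p < 5 → Q ⊆ {2, 3} := by
    intro h5 q hq
    have hqp := (hQ q hq).1
    have h2 := hqp.two_le
    have h5' : q < 5 := (Q.le_max' q hq).trans_lt h5
    interval_cases q <;> first | decide | (revert hqp; decide)
  have hp0 : (0 : ℤ) < p := by exact_mod_cast (hQ p hpQ).1.pos
  have hpM := not_dvd_prod hM (hQ p hpQ).1 (Finset.notMem_erase p Q)
  have hM0 := prod_pos_of_prime hM
  have hMd := hf.isCoprime_prod hM
  have hpp := prime_of_mem hQ hpQ
  have hfp := (hQ p hpQ).2
  have hfM : f (∏ q ∈ Q.erase p, (q : ℤ)) = -f (∏ q ∈ Q, (q : ℤ)) := by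
    rw [← hprod, map_mul, hfp]; ring
  have hcard := hne.card_pos
  rcases Nat.even_or_odd Q.card with hpar | hpar
  · rcases hf.sign with rfl | rfl
    · rw [hfN, hpar.neg_one_pow] at hfM
      have hlast : (5 : ℤ) ≤ p ∨ (∏ q ∈ Q.erase p, (q : ℤ)) * p = 6 := by
        by_cases h5 : p < 5
        · have hle := Finset.card_le_card (hsub h5)
          rw [show ({2, 3} : Finset ℕ).card = 2 by decide] at hle
          have hQeq : Q = {2, 3} := Finset.eq_of_subset_of_card_le (hsub h5) (by
            rw [show ({2, 3} : Finset ℕ).card = 2 by decide]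
            obtain ⟨r, hr⟩ := hpar
            omega)
          rw [hprod]
          refine Or.inr ?_
          rw [hQeq]
          simp
        · left
          omega
      rw [← hprod]
      exact hf.exists_of_pos_of_even hM0 hp0 hpp hpM hMd hfM hfp fun _ => hlast
    · exact hf.exists_of_neg_of_even hne hQ hpar
  · rw [hfN, hpar.neg_one_pow] at hfM
    rw [hpar.neg_one_pow] at hfN
    rcases hf.sign with rfl | rfl
    · exact hf.exists_of_pos_of_odd hN hNd hfN
    · have hd := hf.seven_le
      have hNe : ∏ q ∈ Q, (q : ℤ) ≠ d := by
        intro h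
        rw [h, isCoprime_self, Int.isUnit_iff] at hNd
        omega
      rcases lt_or_gt_of_ne hNe with hlt | hgt
      · rw [← hprod] at hlt ⊢
        refine hf.exists_of_neg_of_odd hM0 hp0 hpp hpM hMd (by simpa using hfM) hfp ?_ hlt
        by_cases h5 : p < 5
        · have hle := Finset.card_le_card (hsub h5)
          rw [show ({2, 3} : Finset ℕ).card = 2 by decide] at hle
          have h0 : (Q.erase p).card = 0 := by
            rw [Finset.card_erase_of_mem hpQ]
            obtain ⟨r, hr⟩ := hpar
            omega
          rw [Finset.card_eq_zero.1 h0]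
          simp
        · left
          omega
      · exact hf.exists_of_odd_of_lt hNd hfN hgt

end Finset

end IsKroneckerCharacter

section Construction

open ZMod

theorem jacobiSym_periodic (a : ℤ) (k : ℤ) (b : ℕ) : jacobiSym (a + b * k) b = jacobiSym a b := by
  rw [jacobiSym.mod_left, Int.add_mul_emod_self_left, ← jacobiSym.mod_left]

theorem isCoprime_of_jacobiSym_ne_zero {a : ℤ} {b : ℕ} (hb : b ≠ 0) (h : jacobiSym a b ≠ 0) :
    IsCoprime a b := by
  have : NeZero b := ⟨hb⟩
  rw [Int.isCoprime_iff_gcd_eq_one]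
  by_contra hgcd
  exact h (jacobiSym.eq_zero_iff_not_coprime.2 hgcd)

/-- The Jacobi symbol with fixed denominator, as a function of the numerator. -/
def jacobiHom (b : ℕ) : ℤ →* ℤ where
  toFun a := jacobiSym a b
  map_one' := jacobiSym.one_left b
  map_mul' a a' := jacobiSym.mul_left a a' b

theorem jacobiHom_apply (b : ℕ) (a : ℤ) : jacobiHom b a = jacobiSym a b := rfl

/-- Quadratic reciprocity with the sign written as a power of `χ₄`. -/
theorem exists_jacobiSym_eq_χ₄_pow_mul {m : ℕ} (hm : Odd m) : ∃ b : ℕ, (-1 : ℤ) ^ b = χ₄ m ∧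
    ∀ q : ℕ, Odd q → jacobiSym m q = χ₄ (q : ℤ) ^ b * jacobiSym q m := by
  have h2 := Nat.odd_iff.1 hm
  rcases (show m % 4 = 1 ∨ m % 4 = 3 by omega) with h | h
  · refine ⟨0, by rw [χ₄_nat_one_mod_four h]; rfl, fun q hq => ?_⟩
    rw [jacobiSym.quadratic_reciprocity_one_mod_four h hq, pow_zero, one_mul]
  · refine ⟨1, by rw [χ₄_nat_three_mod_four h]; rfl, fun q hq => ?_⟩
    have h2 := Nat.odd_iff.1 hq
    rw [pow_one, Int.cast_natCast]
    rcases (show q % 4 = 1 ∨ q % 4 = 3 by omega) with h' | h'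
    · rw [jacobiSym.quadratic_reciprocity_one_mod_four' hm h', χ₄_nat_one_mod_four h', one_mul]
    · rw [jacobiSym.quadratic_reciprocity_three_mod_four h h', χ₄_nat_three_mod_four h']; ring

theorem exists_kroneckerCharacter_of_odd {D : ℤ} (hD : D % 4 = 1) (h7 : 7 ≤ D.natAbs) :
    ∃ f s, IsKroneckerCharacter f D.natAbs s ∧ ∀ q : ℕ, q.Prime → kron D q = f q := by
  set d := D.natAbs with hd
  have hodd : Odd d := Nat.odd_iff.2 (by omega)
  have hs : χ₄ d = 1 ∧ D = d ∧ d % 4 = 1 ∨ χ₄ d = -1 ∧ D = -d ∧ d % 4 = 3 := by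
    rcases (show D = d ∧ d % 4 = 1 ∨ D = -d ∧ d % 4 = 3 by omega) with h | h
    · exact Or.inl ⟨χ₄_nat_one_mod_four h.2, h⟩
    · exact Or.inr ⟨χ₄_nat_three_mod_four h.2, h⟩
  have h2 : jacobiSym 2 d = if d % 8 = 1 ∨ d % 8 = 7 then 1 else -1 := by
    rw [jacobiSym.at_two hodd, χ₈_nat_eq_if_mod_eight, if_neg (by omega)]
  refine ⟨jacobiHom d, χ₄ d, ⟨by omega, by tauto, fun a => ?_, fun a => ?_, fun a ha => ?_, ?_⟩, ?_⟩
  · simpa [jacobiHom_apply] using jacobiSym_periodic a 1 d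
  · exact jacobiSym.neg a hodd
  · exact isCoprime_of_jacobiSym_ne_zero (by omega) ha
  · simp only [jacobiHom_apply, h2]
    by_cases h8 : d % 8 = 1 ∨ d % 8 = 7
    · simp [h8]
    · refine Or.inr (Or.inl ⟨by rw [if_neg h8], fun h => ?_, fun h => ?_⟩)
      · rw [h] at hs
        omega
      · rw [h] at hs
        omega
  · intro q hq
    rw [jacobiHom_apply]
    rcases hq.eq_two_or_odd' with rfl | hqo
    · rw [kron, if_pos rfl]
      push_cast
      rw [h2]
      split_ifs <;> omega
    · have hq2 : q ≠ 2 := by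
        rintro rfl
        exact absurd hqo (by decide)
      rw [kron, if_neg hq2]
      rcases hs with ⟨-, h, h4⟩ | ⟨-, h, h4⟩
      · rw [h, jacobiSym.quadratic_reciprocity_one_mod_four h4 hqo]
      · rw [h, jacobiSym.neg _ hqo]
        have hq2 := Nat.odd_iff.1 hqo
        rcases (show q % 4 = 1 ∨ q % 4 = 3 by omega) with hqm | hqm
        · rw [jacobiSym.quadratic_reciprocity_one_mod_four' hodd hqm, χ₄_nat_one_mod_four hqm,
            one_mul]
        · rw [jacobiSym.quadratic_reciprocity_three_mod_four h4 hqm, χ₄_nat_three_mod_four hqm]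
          ring

/-- The character `n ↦ χ₄(n) ^ a * χ₈(n) ^ k * (n / m)`. -/
def evenHom (a k m : ℕ) : ℤ →* ℤ where
  toFun n := χ₄ (n : ZMod 4) ^ a * χ₈ (n : ZMod 8) ^ k * jacobiSym n m
  map_one' := by simp
  map_mul' x y := by
    simp only [Int.cast_mul, map_mul, mul_pow, jacobiSym.mul_left]
    ring

theorem evenHom_apply (a k m : ℕ) (n : ℤ) :
    evenHom a k m n = χ₄ (n : ZMod 4) ^ a * χ₈ (n : ZMod 8) ^ k * jacobiSym n m := rfl

theorem evenHom_add_half (a k : ℕ) {m : ℕ} (hm : Odd m) :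
    ∃ σ : ℤ, (σ = 1 ∨ σ = -1) ∧
      ∀ n : ℤ, evenHom a k m (n + 2 ^ (k + 1) * m) = σ * evenHom a k m n := by
  have hm2 := Nat.odd_iff.1 hm
  have hJ (n : ℤ) : jacobiSym (n + 2 ^ (k + 1) * m) m = jacobiSym n m := by
    rw [mul_comm]; exact jacobiSym_periodic _ _ _
  rcases (show k = 0 ∨ k = 1 ∨ 2 ≤ k by omega) with rfl | rfl | hk
  · refine ⟨(-1) ^ a, neg_one_pow_eq_or ℤ a, fun n => ?_⟩
    have h4 : χ₄ ((n + 2 ^ (0 + 1) * m : ℤ) : ZMod 4) = -1 * χ₄ (n : ZMod 4) := by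
      simp only [χ₄_int_eq_if_mod_four]
      split_ifs <;> omega
    rw [evenHom_apply, evenHom_apply, hJ, h4, mul_pow]
    ring
  · refine ⟨-1, Or.inr rfl, fun n => ?_⟩
    have h4 : χ₄ ((n + 2 ^ (1 + 1) * m : ℤ) : ZMod 4) = χ₄ (n : ZMod 4) := by
      simp only [χ₄_int_eq_if_mod_four]
      split_ifs <;> omega
    have h8 : χ₈ ((n + 2 ^ (1 + 1) * m : ℤ) : ZMod 8) = -χ₈ (n : ZMod 8) := by
      simp only [χ₈_int_eq_if_mod_eight]
      split_ifs <;> omega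
    rw [evenHom_apply, evenHom_apply, hJ, h4, h8]
    ring
  · refine ⟨1, Or.inl rfl, fun n => ?_⟩
    obtain ⟨j, rfl⟩ := Nat.exists_eq_add_of_le hk
    have hw : n + 2 ^ (2 + j + 1) * (m : ℤ) = n + 8 * (2 ^ j * m) := by ring
    have h4 : χ₄ ((n + 2 ^ (2 + j + 1) * m : ℤ) : ZMod 4) = χ₄ (n : ZMod 4) := by
      rw [hw]
      simp only [χ₄_int_eq_if_mod_four]
      split_ifs <;> omega
    have h8 : χ₈ ((n + 2 ^ (2 + j + 1) * m : ℤ) : ZMod 8) = χ₈ (n : ZMod 8) := by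
      rw [hw]
      simp only [χ₈_int_eq_if_mod_eight]
      split_ifs <;> omega
    rw [evenHom_apply, evenHom_apply, hJ, h4, h8]
    ring

theorem evenHom_neg (a k : ℕ) {m : ℕ} (hm : Odd m) (n : ℤ) :
    evenHom a k m (-n) = (-1) ^ a * χ₄ m * evenHom a k m n := by
  have h4 : χ₄ ((-n : ℤ) : ZMod 4) = -1 * χ₄ (n : ZMod 4) := by
    simp only [χ₄_int_eq_if_mod_four]
    split_ifs <;> omega
  have h8 : χ₈ ((-n : ℤ) : ZMod 8) = χ₈ (n : ZMod 8) := by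
    simp only [χ₈_int_eq_if_mod_eight]
    split_ifs <;> omega
  rw [evenHom_apply, evenHom_apply, h4, h8, jacobiSym.neg n hm, mul_pow]
  ring

theorem odd_of_evenHom_ne_zero {a k m : ℕ} (ha : a ≠ 0) {n : ℤ} (h : evenHom a k m n ≠ 0) :
    Odd n := by
  by_contra h'
  rw [Int.not_odd_iff_even, Int.even_iff] at h'
  refine h ?_
  rw [evenHom_apply, χ₄_int_eq_if_mod_four, if_pos h', zero_pow ha]
  ring

theorem exists_kroneckerCharacter_of_even {D : ℤ} (hD : D % 4 = 0) (h7 : 7 ≤ D.natAbs) :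
    ∃ f s, IsKroneckerCharacter f D.natAbs s ∧ ∀ q : ℕ, q.Prime → kron D q = f q := by
  obtain ⟨k, m, hm, hkm⟩ := Nat.exists_eq_two_pow_mul_odd (n := D.natAbs / 4) (by omega)
  have hd : D.natAbs = 2 ^ (k + 2) * m := by
    rw [show 2 ^ (k + 2) * m = 4 * (2 ^ k * m) by ring, ← hkm]
    omega
  have hdZ : (D.natAbs : ℤ) = 2 * (2 ^ (k + 1) * m) := by
    rw [hd]; push_cast; ring
  have hm0 : m ≠ 0 := by
    rintro rfl
    exact absurd hm (by decide)
  obtain ⟨b, hb, hrec⟩ := exists_jacobiSym_eq_χ₄_pow_mul hm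
  obtain ⟨c, ε, hDε, hc, hε⟩ : ∃ (c : ℕ) (ε : ℤ), D = ε * D.natAbs ∧ (-1) ^ c = ε ∧
      ∀ q : ℕ, Odd q → jacobiSym ε q = χ₄ (q : ℤ) ^ c := by
    rcases le_total 0 D with h | h
    · exact ⟨0, 1, by omega, rfl, fun q _ => by rw [jacobiSym.one_left, pow_zero]⟩
    · refine ⟨1, -1, by omega, rfl, fun q hq => ?_⟩
      rw [jacobiSym.at_neg_one hq, pow_one, Int.cast_natCast]
  obtain ⟨σ, hσ, hhalf⟩ := evenHom_add_half (2 + c + b) k hm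
  have hε1 : ε = 1 ∨ ε = -1 := hc ▸ neg_one_pow_eq_or ℤ c
  refine ⟨evenHom (2 + c + b) k m, ε, ⟨by omega, hε1, fun a => ?_, fun a => ?_, fun a ha => ?_,
    Or.inr (Or.inr ⟨2 ^ (k + 1) * m, σ, hdZ, ?_, hσ, hhalf⟩)⟩, fun q hq => ?_⟩
  · rw [hdZ, two_mul, ← add_assoc, hhalf, hhalf]
    rcases hσ with rfl | rfl <;> ring
  · rw [evenHom_neg _ _ hm, ← hb, pow_add, pow_add, hc]
    rcases neg_one_pow_eq_or ℤ b with h | h <;> rw [h] <;> ring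
  · have hodd := odd_of_evenHom_ne_zero (by omega) ha
    have h2 : IsCoprime a 2 := by
      obtain ⟨j, rfl⟩ := hodd
      exact ⟨1, -j, by ring⟩
    rw [hdZ, ← mul_assoc]
    exact (h2.mul_right h2.pow_right).mul_right
      (isCoprime_of_jacobiSym_ne_zero hm0 fun h => ha (by rw [evenHom_apply, h, mul_zero]))
  · exact (dvd_pow_self 2 k.succ_ne_zero).mul_right _
  · rcases hq.eq_two_or_odd' with rfl | hqo
    · rw [kron, if_pos rfl, if_neg (by omega), if_neg (by omega)]
      by_contra h
      exact absurd (odd_of_evenHom_ne_zero (by omega) (Ne.symm h)) (by decide)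
    · have hq2 : q ≠ 2 := by
        rintro rfl
        exact absurd hqo (by decide)
      have h4 : χ₄ ((q : ℤ) : ZMod 4) ^ 2 = 1 := by
        have := Nat.odd_iff.1 hqo
        rw [χ₄_int_eq_if_mod_four, if_neg (by omega)]
        split_ifs <;> norm_num
      have h8 : χ₈ ((q : ℤ) : ZMod 8) ^ 2 = 1 := by
        have := Nat.odd_iff.1 hqo
        rw [χ₈_int_eq_if_mod_eight, if_neg (by omega)]
        split_ifs <;> norm_num
      rw [kron, if_neg hq2, hDε, hd, Nat.cast_mul, Nat.cast_pow, jacobiSym.mul_left,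
        jacobiSym.mul_left, jacobiSym.pow_left, hε q hqo, hrec q hqo, Nat.cast_ofNat,
        jacobiSym.at_two hqo, evenHom_apply, pow_add _ k 2, pow_add, pow_add, h4,
        ← Int.cast_natCast (R := ZMod 8), h8]
      ring

end Construction

theorem exists_kroneckerCharacter {D : ℤ} (hD : D % 4 = 0 ∨ D % 4 = 1) (h7 : 7 ≤ D.natAbs) :
    ∃ f s, IsKroneckerCharacter f D.natAbs s ∧ ∀ q : ℕ, q.Prime → kron D q = f q :=
  hD.elim (exists_kroneckerCharacter_of_even · h7) (exists_kroneckerCharacter_of_odd · h7)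

theorem kron_trichotomy (D : ℤ) (q : ℕ) : kron D q = 0 ∨ kron D q = 1 ∨ kron D q = -1 := by
  rw [kron]
  split_ifs
  · exact Or.inr (Or.inl rfl)
  · exact Or.inr (Or.inr rfl)
  · exact Or.inl rfl
  · exact jacobiSym.trichotomy D q

/-- Every positive integer `n` with `f n < 0` has a prime factor `q` with `f q = -1`, provided
that `f` takes no values other than `0`, `1` and `-1` on primes. -/
theorem exists_prime_dvd_of_map_neg {f : ℤ →* ℤ}
    (hf : ∀ q : ℕ, q.Prime → f q = 0 ∨ f q = 1 ∨ f q = -1) {n : ℕ} (hn : n ≠ 0)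
    (hfn : f n < 0) : ∃ q : ℕ, q.Prime ∧ q ∣ n ∧ f q = -1 := by
  contrapose! hfn
  induction n using Nat.recOnMul with
  | zero => exact absurd rfl hn
  | one => simp
  | prime p hp =>
    have := hfn p hp dvd_rfl
    have := hf p hp
    omega
  | mul a b iha ihb =>
    rw [Nat.cast_mul, map_mul]
    exact mul_nonneg
      (iha (left_ne_zero_of_mul hn) fun q hq hqa => hfn q hq (hqa.mul_right b))
      (ihb (right_ne_zero_of_mul hn) fun q hq hqb => hfn q hq (hqb.mul_left a))

theorem IsKroneckerCharacter.nth_lt_prod_range {f : ℤ →* ℤ} {d : ℕ} {s : ℤ}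
    (hf : IsKroneckerCharacter f d s)
    (hval : ∀ q : ℕ, q.Prime → f q = 0 ∨ f q = 1 ∨ f q = -1) {i₀ : ℕ}
    (hgt : d < Nat.nth (fun q => q.Prime ∧ f q = -1) i₀) {i : ℕ} (hi : i₀ ≤ i) :
    Nat.nth (fun q => q.Prime ∧ f q = -1) i <
      ∏ j ∈ Finset.range i, Nat.nth (fun q => q.Prime ∧ f q = -1) j := by
  set P : ℕ → Prop := fun q => q.Prime ∧ f q = -1 with hPdef
  have h7 := hf.seven_le
  have hcard : ∀ h : (Set.ofPred P).Finite, i₀ < h.toFinset.card := fun h =>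
    Nat.lt_card_toFinset_of_nth_ne_zero (by omega) h
  have hindex {q j : ℕ} (hq : P q) (hlt : q < Nat.nth P j) : ∃ m < j, Nat.nth P m = q := by
    obtain ⟨m, hm, rfl⟩ := Nat.exists_lt_card_nth_eq hq
    refine ⟨m, ?_, rfl⟩
    by_contra! hjm
    exact absurd (Nat.nth_le_nth' hjm hm) (by omega)
  have hpos : i₀ ≠ 0 := by
    have hmem : P (Nat.nth P i₀) := Nat.nth_mem i₀ hcard
    have hfr : f ((Nat.nth P i₀ % d : ℕ) : ℤ) = -1 := by
      rw [← hmem.2, ← hf.map_add_mul _ (Nat.nth P i₀ / d : ℕ)]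
      congr 1
      exact_mod_cast Nat.mod_add_div' (Nat.nth P i₀) d
    have hr0 : Nat.nth P i₀ % d ≠ 0 := fun h => hf.ne_zero hfr (by rw [h]; rfl)
    obtain ⟨q, hq, hqd, hfq⟩ := exists_prime_dvd_of_map_neg hval hr0 (by rw [hfr]; norm_num)
    have hqle := Nat.le_of_dvd (Nat.pos_of_ne_zero hr0) hqd
    have hrlt := Nat.mod_lt (Nat.nth P i₀) (show 0 < d by omega)
    obtain ⟨m, hm, -⟩ := hindex (j := i₀) ⟨hq, hfq⟩ (by omega)
    omega
  suffices h : (∀ h : (Set.ofPred P).Finite, i < h.toFinset.card) ∧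
      Nat.nth P i < ∏ j ∈ Finset.range i, Nat.nth P j from h.2
  induction i using Nat.strong_induction_on with
  | _ i ih =>
    have hreal (j : ℕ) (hj : j < i) (h : (Set.ofPred P).Finite) : j < h.toFinset.card := by
      rcases lt_or_ge j i₀ with h' | h'
      · exact h'.trans (hcard h)
      · exact (ih j hj h').1 h
    have hinj : Set.InjOn (Nat.nth P) (Finset.range i) := by
      intro j hj k hk hjk
      have hj := hreal j (Finset.mem_range.1 hj)
      have hk := hreal k (Finset.mem_range.1 hk)
      rcases lt_trichotomy j k with h | h | h
      · exact absurd (Nat.nth_lt_nth' h hk) (by omega)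
      · exact h
      · exact absurd (Nat.nth_lt_nth' h hj) (by omega)
    obtain ⟨n, hn⟩ := hf.exists_isSmallNonresidue (Q := (Finset.range i).image (Nat.nth P))
      ((Finset.nonempty_range_iff.2 (by omega)).image _) fun q hq => by
        obtain ⟨j, hj, rfl⟩ := Finset.mem_image.1 hq
        exact Nat.nth_mem j (hreal j (Finset.mem_range.1 hj))
    rw [Finset.prod_image hinj] at hn
    obtain ⟨hn0, hnlt, hncop, hfn⟩ := hn
    lift n to ℕ using hn0.le
    obtain ⟨q, hq, hqn, hfq⟩ := exists_prime_dvd_of_map_neg hval (n := n) (by omega)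
      (by rw [hfn]; norm_num)
    have hqle := Nat.le_of_dvd (by omega) hqn
    have hmem : P q := ⟨hq, hfq⟩
    have hnot (j : ℕ) (hj : j < i) : Nat.nth P j ≠ q := by
      rintro rfl
      have hdvd := Finset.dvd_prod_of_mem (fun j => (Nat.nth P j : ℤ)) (Finset.mem_range.2 hj)
      exact (Nat.prime_iff_prime_int.1 hq).not_isUnit
        (hncop.isUnit_of_dvd' (Int.natCast_dvd_natCast.2 hqn) hdvd)
    have hdn : d ≤ n := by
      by_contra! hnd
      obtain ⟨m, hm, hmq⟩ := hindex hmem (show q < Nat.nth P i₀ by omega)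
      exact hnot m (by omega) hmq
    have hnN : n < ∏ j ∈ Finset.range i, Nat.nth P j := by
      rcases lt_max_iff.1 hnlt with h | h
      · exact_mod_cast h
      · omega
    obtain ⟨m, hm, rfl⟩ := Nat.exists_lt_card_nth_eq hmem
    have him : i ≤ m := by
      by_contra! h
      exact hnot m h rfl
    exact ⟨fun h => him.trans_lt (hm h),
      (Nat.nth_le_nth' him hm).trans_lt (hqle.trans_lt hnN)⟩

theorem stmt14 (D : ℤ) (hD : D % 4 = 0 ∨ D % 4 = 1) (hns : ¬ IsSquare D)
    (h3 : D ≠ -3) (h4 : D ≠ -4) (h5 : D ≠ 5) (d : ℕ) (hd : d = D.natAbs)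
    (i₀ : ℕ)
    (hgt : d < Nat.nth (fun q => q.Prime ∧ kron D q = -1) i₀)
    (hle : ∀ j < i₀, Nat.nth (fun q => q.Prime ∧ kron D q = -1) j ≤ d) :
    ∀ i : ℕ, i₀ ≤ i →
      Nat.nth (fun q => q.Prime ∧ kron D q = -1) i <
        ∏ j ∈ Finset.range i, Nat.nth (fun q => q.Prime ∧ kron D q = -1) j := by
  have h7 : 7 ≤ D.natAbs := by
    have h0 : D ≠ 0 := by rintro rfl; exact hns ⟨0, rfl⟩
    have h1 : D ≠ 1 := by rintro rfl; exact hns ⟨1, rfl⟩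
    have h2 : D ≠ 4 := by rintro rfl; exact hns ⟨2, rfl⟩
    omega
  obtain ⟨f, s, hf, hk⟩ := exists_kroneckerCharacter hD h7
  have hP : (fun q : ℕ => q.Prime ∧ kron D q = -1) = fun q : ℕ => q.Prime ∧ f q = -1 :=
    funext fun q => propext (and_congr_right fun hq => by rw [hk q hq])
  intro i hi
  rw [hP] at hgt ⊢
  rw [hd] at hgt
  exact hf.nth_lt_prod_range (fun q hq => hk q hq ▸ kron_trichotomy D q) hgt hi
end

section
/- Let a, b, c be positive integers with a ≤ b ≤ c whose odd parts are pairwise coprime, and suppose that for each n ∈ {1, 3, 5, 7} the congruence a·x² + b·y² + c·z² ≡ n (mod 8) is solvable. If the ternary quadratic form a·x² + b·y² + c·z² is regular, then c ≤ 4ab + 3·δ, where δ = 1 if ab = 1 and δ = 0 otherwise. -/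
/-- A ternary diagonal form `a x² + b y² + c z²` (with `a,b,c > 0`) is regular if every
natural number represented over `ℤ_p` for every prime `p` (representation over `ℝ` being
automatic for positive forms) is represented over `ℤ`. -/
def RegularTernaryForm (a b c : ℕ) : Prop :=
  ∀ n : ℕ,
    (∀ (p : ℕ) [Fact p.Prime],
      ∃ x y z : ℤ_[p], (a : ℤ_[p]) * x ^ 2 + (b : ℤ_[p]) * y ^ 2 + (c : ℤ_[p]) * z ^ 2 = n) →
    ∃ x y z : ℤ, (a : ℤ) * x ^ 2 + (b : ℤ) * y ^ 2 + (c : ℤ) * z ^ 2 = n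

open scoped NumberTheorySymbols

/-! ### Local solvability -/

/-- Hensel lifting for `a x² = m` with `a x` a `p`-adic unit. -/
theorem exists_padicInt_mul_sq_eq (p : ℕ) [hp : Fact p.Prime] (a x m : ℤ) (hax : ¬ (p : ℤ) ∣ a * x)
    (h : ((if p = 2 then 8 else p : ℕ) : ℤ) ∣ a * x ^ 2 - m) :
    ∃ X : ℤ_[p], (a : ℤ_[p]) * X ^ 2 = m := by
  have hunit : ‖((a * x : ℤ) : ℤ_[p])‖ = 1 :=
    le_antisymm (PadicInt.norm_le_one _)
      (not_lt.1 fun hlt => hax ((PadicInt.norm_int_lt_one_iff_dvd _).1 hlt))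
  let F : Polynomial ℤ_[p] :=
    Polynomial.C (a : ℤ_[p]) * Polynomial.X ^ 2 - Polynomial.C (m : ℤ_[p])
  have hF (z : ℤ_[p]) : F.aeval z = a * z ^ 2 - m := by simp [F]
  have hF' (z : ℤ_[p]) : F.derivative.aeval z = 2 * (a * z) := by
    simp [F]; ring
  have hlt : ‖F.aeval (x : ℤ_[p])‖ < ‖F.derivative.aeval (x : ℤ_[p])‖ ^ 2 := by
    rw [hF, hF', norm_mul]
    have e1 : (a : ℤ_[p]) * (x : ℤ_[p]) = ((a * x : ℤ) : ℤ_[p]) := by push_cast; ring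
    have e2 : (a : ℤ_[p]) * (x : ℤ_[p]) ^ 2 - m = ((a * x ^ 2 - m : ℤ) : ℤ_[p]) := by
      push_cast; ring
    rw [e1, hunit, e2, mul_one]
    by_cases hp2 : p = 2
    · subst hp2
      have h8 : ‖((a * x ^ 2 - m : ℤ) : ℤ_[2])‖ ≤ ((2 : ℕ) : ℝ) ^ (-((3 : ℕ) : ℤ)) := by
        rw [PadicInt.norm_int_le_pow_iff_dvd]
        simpa using h
      have h2 : ‖(2 : ℤ_[2])‖ = 2⁻¹ := by
        simpa using PadicInt.norm_p (p := 2)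
      rw [h2]
      refine lt_of_le_of_lt h8 ?_
      norm_num [zpow_neg]
    · have h2 : ‖((2 : ℤ) : ℤ_[p])‖ = 1 := by
        refine le_antisymm (PadicInt.norm_le_one _) (not_lt.1 fun hlt => hp2 ?_)
        have h3 := (PadicInt.norm_int_lt_one_iff_dvd _).1 hlt
        exact (Nat.prime_dvd_prime_iff_eq hp.out Nat.prime_two).1 (by exact_mod_cast h3)
      rw [if_neg hp2] at h
      have := (PadicInt.norm_int_lt_one_iff_dvd (p := p) _).2 h
      push_cast at h2
      rw [h2]
      simpa using this
  obtain ⟨z, hz, -⟩ := hensels_lemma hlt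
  exact ⟨z, by rw [hF] at hz; exact sub_eq_zero.1 hz⟩

/-- A congruence solution modulo `p` (modulo `8` if `p = 2`) lifts to `ℤ_p` when one of its terms
is a `p`-adic unit. -/
theorem exists_padicInt_of_congruence (p : ℕ) [hp : Fact p.Prime] (a b c n : ℕ) (x y z : ℤ)
    (hxyz : ¬ ((p : ℤ) ∣ a * x ∧ (p : ℤ) ∣ b * y ∧ (p : ℤ) ∣ c * z))
    (h : ((if p = 2 then 8 else p : ℕ) : ℤ) ∣ a * x ^ 2 + b * y ^ 2 + c * z ^ 2 - n) :
    ∃ x y z : ℤ_[p], (a : ℤ_[p]) * x ^ 2 + (b : ℤ_[p]) * y ^ 2 + (c : ℤ_[p]) * z ^ 2 = n := by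
  by_cases hx : (p : ℤ) ∣ a * x
  · by_cases hy : (p : ℤ) ∣ b * y
    · by_cases hz : (p : ℤ) ∣ c * z
      · exact absurd ⟨hx, hy, hz⟩ hxyz
      · obtain ⟨Z, hZ⟩ := exists_padicInt_mul_sq_eq p c z (n - a * x ^ 2 - b * y ^ 2) hz
          (by convert h using 1; ring)
        refine ⟨x, y, Z, ?_⟩
        push_cast at hZ
        linear_combination hZ
    · obtain ⟨Y, hY⟩ := exists_padicInt_mul_sq_eq p b y (n - a * x ^ 2 - c * z ^ 2) hy
        (by convert h using 1; ring)
      refine ⟨x, Y, z, ?_⟩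
      push_cast at hY
      linear_combination hY
  · obtain ⟨X, hX⟩ := exists_padicInt_mul_sq_eq p a x (n - b * y ^ 2 - c * z ^ 2) hx
      (by convert h using 1; ring)
    refine ⟨X, y, z, ?_⟩
    push_cast at hX
    linear_combination hX

/-- A binary diagonal form with unit coefficients is universal modulo an odd prime. -/
theorem exists_dvd_mul_sq_add_mul_sq_sub (p : ℕ) [hp : Fact p.Prime] (hp2 : p ≠ 2) (u v : ℕ) (n : ℤ)
    (hu : ¬ p ∣ u) (hv : ¬ p ∣ v) : ∃ x y : ℤ, (p : ℤ) ∣ u * x ^ 2 + v * y ^ 2 - n := by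
  have hu' : (u : ZMod p) ≠ 0 := fun h => hu ((ZMod.natCast_eq_zero_iff _ _).1 h)
  have hv' : (v : ZMod p) ≠ 0 := fun h => hv ((ZMod.natCast_eq_zero_iff _ _).1 h)
  let f : Polynomial (ZMod p) := Polynomial.C (u : ZMod p) * Polynomial.X ^ 2
  let g : Polynomial (ZMod p) :=
    Polynomial.C (v : ZMod p) * Polynomial.X ^ 2 - Polynomial.C (n : ZMod p)
  have hf : f.degree = 2 := Polynomial.degree_C_mul_X_pow 2 hu'
  have hg : g.degree = 2 := by
    have h2 : (Polynomial.C (v : ZMod p) * Polynomial.X ^ 2).degree = 2 :=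
      Polynomial.degree_C_mul_X_pow 2 hv'
    rw [Polynomial.degree_sub_C (by rw [h2]; norm_num), h2]
  obtain ⟨x, y, hxy⟩ := FiniteField.exists_root_sum_quadratic hf hg
    (by rw [ZMod.card]; exact hp.out.eq_two_or_odd.resolve_left hp2)
  refine ⟨x.val, y.val, ?_⟩
  rw [← ZMod.intCast_zmod_eq_zero_iff_dvd]
  simp only [f, g, Polynomial.eval_mul, Polynomial.eval_sub, Polynomial.eval_C,
    Polynomial.eval_pow, Polynomial.eval_X] at hxy
  push_cast
  simp only [ZMod.natCast_val, ZMod.cast_id', id]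
  linear_combination hxy

theorem not_dvd_of_coprime_ordCompl_two {p a b : ℕ} (hp : p.Prime) (hp2 : p ≠ 2)
    (h : Nat.Coprime (ordCompl[2] a) (ordCompl[2] b)) (ha : p ∣ a) : ¬ p ∣ b := by
  have key (m : ℕ) (hm : p ∣ m) : p ∣ ordCompl[2] m := by
    rw [← Nat.ordProj_mul_ordCompl_eq_self m 2] at hm
    refine (hp.dvd_mul.1 hm).resolve_left fun h' => hp2 ?_
    exact (Nat.prime_dvd_prime_iff_eq hp Nat.prime_two).1 (hp.dvd_of_dvd_pow h')
  intro hb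
  exact Nat.not_coprime_of_dvd_of_dvd hp.one_lt (key a ha) (key b hb) h

/-- Dickson's criterion: a regular form with pairwise coprime odd parts that represents
every odd class modulo `8` represents every odd integer prime to
its coefficients. -/
theorem RegularTernaryForm.exists_rep {a b c : ℕ} (hreg : RegularTernaryForm a b c)
    (hab : Nat.Coprime (ordCompl[2] a) (ordCompl[2] b))
    (hac : Nat.Coprime (ordCompl[2] a) (ordCompl[2] c))
    (hbc : Nat.Coprime (ordCompl[2] b) (ordCompl[2] c))
    (hsolv : ∀ n : ZMod 8, n = 1 ∨ n = 3 ∨ n = 5 ∨ n = 7 →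
      ∃ x y z : ZMod 8, (a : ZMod 8) * x ^ 2 + (b : ZMod 8) * y ^ 2 + (c : ZMod 8) * z ^ 2 = n)
    {n : ℕ} (hodd : n % 2 = 1) (hn : n.Coprime (a * b * c)) :
    ∃ x y z : ℤ, (a : ℤ) * x ^ 2 + (b : ℤ) * y ^ 2 + (c : ℤ) * z ^ 2 = n := by
  refine hreg n fun p hp => ?_
  have hterms {x y z : ℤ} (h : (p : ℤ) ∣ a * x ^ 2 + b * y ^ 2 + c * z ^ 2 - n) (hpn : ¬ p ∣ n) :
      ¬ ((p : ℤ) ∣ a * x ∧ (p : ℤ) ∣ b * y ∧ (p : ℤ) ∣ c * z) := by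
    rintro ⟨hx, hy, hz⟩
    refine hpn ?_
    have e : (n : ℤ) = (a * x) * x + (b * y) * y + (c * z) * z -
      (a * x ^ 2 + b * y ^ 2 + c * z ^ 2 - n) := by ring
    have : (p : ℤ) ∣ n := by
      rw [e]
      exact dvd_sub (dvd_add (dvd_add (hx.mul_right _) (hy.mul_right _)) (hz.mul_right _)) h
    exact_mod_cast this
  by_cases hp2 : p = 2
  · subst hp2
    have h8 : (n : ZMod 8) = 1 ∨ (n : ZMod 8) = 3 ∨ (n : ZMod 8) = 5 ∨ (n : ZMod 8) = 7 := by
      have h : n % 8 = 1 ∨ n % 8 = 3 ∨ n % 8 = 5 ∨ n % 8 = 7 := by omega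
      rw [← ZMod.natCast_mod n 8]
      rcases h with h | h | h | h <;> rw [h] <;> simp
    obtain ⟨x, y, z, h⟩ := hsolv n h8
    have hdvd : (8 : ℤ) ∣ a * (x.val : ℤ) ^ 2 + b * (y.val : ℤ) ^ 2 + c * (z.val : ℤ) ^ 2 - n := by
      rw [← Nat.cast_ofNat, ← ZMod.intCast_zmod_eq_zero_iff_dvd]
      push_cast
      simp only [ZMod.natCast_val, ZMod.cast_id', id]
      linear_combination h
    refine exists_padicInt_of_congruence 2 a b c n x.val y.val z.val
      (hterms ?_ fun h2 => ?_) (by rw [if_pos rfl]; exact hdvd)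
    · exact dvd_trans (by norm_num) hdvd
    · omega
  · by_cases hpn : p ∣ n
    · have hd : ¬ p ∣ a * b * c := fun h => Nat.not_coprime_of_dvd_of_dvd hp.out.one_lt hpn h hn
      have ha : ¬ p ∣ a := fun h => hd ((h.mul_right b).mul_right c)
      have hb : ¬ p ∣ b := fun h => hd ((h.mul_left a).mul_right c)
      have hc : ¬ p ∣ c := fun h => hd (h.mul_left _)
      obtain ⟨x, y, h⟩ := exists_dvd_mul_sq_add_mul_sq_sub p hp2 a b (n - c) ha hb
      refine exists_padicInt_of_congruence p a b c n x y 1 (fun h1 => hc ?_) ?_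
      · have := h1.2.2
        rw [mul_one] at this
        exact_mod_cast this
      · rw [if_neg hp2]
        convert h using 1
        ring
    · have hred {x y z : ℤ} (h : (p : ℤ) ∣ a * x ^ 2 + b * y ^ 2 + c * z ^ 2 - n) :=
        exists_padicInt_of_congruence p a b c n x y z (hterms h hpn) (by rwa [if_neg hp2])
      by_cases ha : p ∣ a
      · obtain ⟨y, z, h⟩ := exists_dvd_mul_sq_add_mul_sq_sub p hp2 b c n
          (not_dvd_of_coprime_ordCompl_two hp.out hp2 hab ha)
          (not_dvd_of_coprime_ordCompl_two hp.out hp2 hac ha)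
        exact hred (x := 0) (y := y) (z := z) (by convert h using 1; ring)
      · by_cases hb : p ∣ b
        · obtain ⟨x, z, h⟩ := exists_dvd_mul_sq_add_mul_sq_sub p hp2 a c n ha
            (not_dvd_of_coprime_ordCompl_two hp.out hp2 hbc hb)
          exact hred (x := x) (y := 0) (z := z) (by convert h using 1; ring)
        · obtain ⟨x, y, h⟩ := exists_dvd_mul_sq_add_mul_sq_sub p hp2 a b n ha hb
          exact hred (x := x) (y := y) (z := 0) (by convert h using 1; ring)

/-! ### The Euclid-type inequality -/

theorem jacobiSym_neg_eq_of_modEq {b N A : ℕ} (hN : N % 2 = 1) (hA : A % 2 = 1)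
    (h : N ≡ A [MOD 4 * b]) : J(-(b : ℤ) | N) = J(-(b : ℤ) | A) := by
  rw [jacobiSym.mod_right _ (Nat.odd_iff.2 hN), jacobiSym.mod_right _ (Nat.odd_iff.2 hA)]
  rw [Int.natAbs_neg, Int.natAbs_natCast, h]

theorem jacobiSym_neg_four_mul_sub_one {b : ℕ} (hb : 0 < b) : J(-(b : ℤ) | 4 * b - 1) = -1 := by
  have hodd : Odd (4 * b - 1) := Nat.odd_iff.2 (by omega)
  have h4 : J((b : ℤ) | 4 * b - 1) = 1 := by
    have h : J(4 * (b : ℤ) | 4 * b - 1) = J(1 | 4 * b - 1) := by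
      refine jacobiSym.mod_left' (Int.ModEq.symm (Int.modEq_iff_dvd.2 ?_))
      rw [Nat.cast_sub (by omega)]
      push_cast
      exact dvd_rfl
    rwa [jacobiSym.mul_left, jacobiSym.at_four hodd, one_mul, jacobiSym.one_left] at h
  rw [jacobiSym.neg _ hodd, h4, mul_one, ZMod.χ₄_nat_three_mod_four (by omega)]

theorem jacobiSym_neg_eq_neg_of_dvd_add {b N A : ℕ} (hb : 0 < b) (hN : N % 2 = 1)
    (hA : A % 2 = 1) (hAb : A.Coprime b) (h : 4 * b ∣ N + A) :
    J(-(b : ℤ) | N) = -J(-(b : ℤ) | A) := by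
  have hg : (-(b : ℤ)).gcd A = 1 := by
    rw [Int.neg_gcd, Int.gcd_natCast_natCast]
    exact hAb.symm
  have hM : ((4 * b - 1) * A) % 2 = 1 := by
    rw [Nat.mul_mod, hA]; omega
  have hmod : N ≡ (4 * b - 1) * A [MOD 4 * b] := by
    refine Nat.ModEq.add_right_cancel' A ?_
    have e : (4 * b - 1) * A + A = 4 * b * A := by
      rw [Nat.sub_mul, one_mul, Nat.sub_add_cancel]
      nlinarith
    rw [e]
    exact ((Nat.modEq_zero_iff_dvd.2 h).trans
      (Nat.modEq_zero_iff_dvd.2 (dvd_mul_right _ _)).symm)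
  have : NeZero (4 * b - 1) := ⟨by omega⟩
  have : NeZero A := ⟨by omega⟩
  rw [jacobiSym_neg_eq_of_modEq hN hM hmod, jacobiSym.mul_right,
    jacobiSym_neg_four_mul_sub_one hb, neg_one_mul]

/-- If every prime below `c` at which `-b` is a nonresidue divides `c`, then `c` is bounded. -/
theorem lt_eight_mul_of_forall_prime_dvd {b c : ℕ} (hb : 0 < b) (hc : 4 * b < c)
    (h : ∀ q : ℕ, q.Prime → q < c → J(-(b : ℤ) | q) = -1 → q % 2 = 1 → q ∣ c) :
    c < 8 * b := by
  set S := c.primeFactors.filter fun q => J(-(b : ℤ) | q) = -1 ∧ q % 2 = 1 with hS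
  have hSmem (q : ℕ) (hq : q ∈ S) :
      q.Prime ∧ q ∣ c ∧ J(-(b : ℤ) | q) = -1 ∧ q % 2 = 1 := by
    rw [hS, Finset.mem_filter, Nat.mem_primeFactors] at hq
    exact ⟨hq.1.1, hq.1.2.1, hq.2⟩
  set P := ∏ q ∈ S, q with hP
  have hPodd : P % 2 = 1 := by
    rw [← Nat.odd_iff, ← Nat.coprime_two_right]
    exact Nat.Coprime.prod_left fun q hq =>
      Nat.coprime_two_right.2 (Nat.odd_iff.2 (hSmem q hq).2.2.2)
  have hqb (q : ℕ) (hq : q ∈ S) : q.Coprime b := by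
    rw [Nat.coprime_comm]
    by_contra hcop
    have : NeZero q := ⟨(hSmem q hq).1.ne_zero⟩
    have h0 : J(-(b : ℤ) | q) = 0 := by
      rw [jacobiSym.eq_zero_iff_not_coprime, Int.neg_gcd, Int.gcd_natCast_natCast]
      exact hcop
    rw [(hSmem q hq).2.2.1] at h0
    norm_num at h0
  have hPb : P.Coprime b := Nat.Coprime.prod_left hqb
  have hP4b : P.Coprime (4 * b) := by
    refine Nat.Coprime.mul_right ?_ hPb
    exact Nat.Coprime.pow_right 2 (Nat.coprime_two_right.2 (Nat.odd_iff.2 hPodd))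
  have hPc : P ≤ c := by
    refine Nat.le_of_dvd (by omega) ((Finset.prod_dvd_prod_of_subset _ _ _ ?_).trans
      (Nat.prod_primeFactors_dvd c))
    exact Finset.filter_subset _ _
  have key (N : ℕ) (hN : N % 2 = 1) (hNc : N < c) (hNP : N.Coprime P) :
      J(-(b : ℤ) | N) ≠ -1 := by
    intro hJ
    obtain ⟨q, hq, hqN, hJq⟩ := jacobiSym.eq_neg_one_at_prime_divisor_of_eq_neg_one hJ
    have hqodd : q % 2 = 1 := Nat.odd_iff.1 ((Nat.odd_iff.2 hN).of_dvd_nat hqN)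
    have hqc := h q hq ((Nat.le_of_dvd (by omega) hqN).trans_lt hNc) hJq hqodd
    have hqS : q ∈ S := by
      rw [hS, Finset.mem_filter, Nat.mem_primeFactors]
      exact ⟨⟨hq, hqc, by omega⟩, hJq, hqodd⟩
    exact Nat.not_coprime_of_dvd_of_dvd hq.one_lt hqN (Finset.dvd_prod_of_mem _ hqS) hNP
  have hPg : (-(b : ℤ)).gcd P = 1 := by
    rw [Int.neg_gcd, Int.gcd_natCast_natCast]
    exact hPb.symm
  rcases jacobiSym.eq_one_or_neg_one hPg with hJ | hJ
  · exfalso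
    have hex : ∃ i, P < 4 * b * 2 ^ i := by
      refine ⟨P, Nat.lt_two_pow_self.trans_le (Nat.le_mul_of_pos_left _ (by omega))⟩
    have hlt := Nat.find_spec hex
    have hmin := fun {m} => Nat.find_min hex (m := m)
    set i := Nat.find hex
    have heven (k : ℕ) : 2 ∣ 4 * b * 2 ^ k :=
      ((by norm_num : 2 ∣ 4).mul_right b).mul_right _
    have hi := heven i
    refine key (4 * b * 2 ^ i - P) ?_ ?_ ?_ ?_
    · omega
    · rcases Nat.eq_zero_or_pos i with h0 | hpos
      · rw [h0]; omega
      · obtain ⟨j, hj⟩ : ∃ j, i = j + 1 := ⟨i - 1, by omega⟩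
        have := hmin (m := j) (by omega)
        have := heven j
        rw [hj, pow_succ, ← mul_assoc] at hlt ⊢
        omega
    · rw [Nat.coprime_sub_self_left hlt.le]
      refine Nat.Coprime.mul_left hP4b.symm (Nat.Coprime.pow_left _ ?_)
      exact Nat.coprime_two_left.2 (Nat.odd_iff.2 hPodd)
    · rw [jacobiSym_neg_eq_neg_of_dvd_add hb _ hPodd hPb, hJ]
      · rw [Nat.sub_add_cancel hlt.le]
        exact dvd_mul_right _ _
      · omega
  · rcases lt_or_ge (4 * b) P with hlt | hle
    · refine absurd ?_ (key (P - 4 * b) (by omega) (by omega) ?_)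
      · rw [jacobiSym_neg_eq_of_modEq (by omega) hPodd, hJ]
        refine Nat.ModEq.add_right_cancel' (4 * b) ?_
        rw [Nat.sub_add_cancel hlt.le]
        simp [Nat.ModEq]
      · rw [Nat.coprime_comm, Nat.coprime_self_sub_right hlt.le]
        exact hP4b
    · by_contra! hc8
      refine key (P + 4 * b) (by omega) (by omega) ?_ ?_
      · rw [Nat.coprime_comm, Nat.coprime_self_add_right]
        exact hP4b
      · rw [jacobiSym_neg_eq_of_modEq (by omega) hPodd, hJ]
        simp [Nat.ModEq]

/-! ### Forms `x² + b y² + c z²` -/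

theorem prime_not_rep_of_jacobiSym_eq_neg_one {b q : ℕ} (hq : q.Prime)
    (h : J(-(b : ℤ) | q) = -1) (x y : ℤ) : x ^ 2 + b * y ^ 2 ≠ q := by
  intro hxy
  have : Fact q.Prime := ⟨hq⟩
  obtain ⟨⟨u, rfl⟩, v, rfl⟩ := jacobiSym.prime_dvd_of_eq_neg_one h (x := x) (y := y)
    ⟨1, by linear_combination hxy⟩
  have hq0 : (q : ℤ) ≠ 0 := by exact_mod_cast hq.ne_zero
  have h1 : (q : ℤ) * (u ^ 2 + b * v ^ 2) = 1 := by
    apply mul_left_cancel₀ hq0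
    linear_combination hxy
  have h2 : (q : ℤ) ∣ 1 := ⟨_, h1.symm⟩
  exact hq.one_lt.ne' (by exact_mod_cast Int.eq_one_of_dvd_one (by positivity) h2)

theorem exists_not_rep_of_lt_fourteen : ∀ b ∈ Finset.Icc 1 13,
    ∀ c ∈ Finset.Ioo (4 * b + (if b = 1 then 3 else 0)) (8 * b),
      ∃ n ∈ Finset.range c, n % 2 = 1 ∧ n.Coprime (b * c) ∧
        ∀ x ∈ Finset.range 11, ∀ y ∈ Finset.range 11, x ^ 2 + b * y ^ 2 ≠ n := by
  decide +kernel

/-- Bertrand's postulate makes the odd primes below `b` too many to divide `b * c`. -/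
theorem lt_of_forall_prime_dvd {b c : ℕ} (hc0 : 0 < c) (hc : c < 8 * b)
    (h : ∀ p : ℕ, p.Prime → p < b → p % 2 = 1 → p ∣ b * c) : b < 14 := by
  by_contra! hb
  have hbc : 0 < b * c := Nat.mul_pos (by omega) hc0
  have h3 := h 3 (by norm_num) (by omega) (by norm_num)
  have h5 := h 5 (by norm_num) (by omega) (by norm_num)
  have h7 := h 7 (by norm_num) (by omega) (by norm_num)
  have h11 := h 11 (by norm_num) (by omega) (by norm_num)
  have h13 := h 13 (by norm_num) (by omega) (by norm_num)
  have h105 : 105 ∣ b * c :=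
    Nat.Coprime.mul_dvd_of_dvd_of_dvd (m := 15) (by norm_num)
      (Nat.Coprime.mul_dvd_of_dvd_of_dvd (by norm_num) h3 h5) h7
  have hlt : b * c < 8 * b ^ 2 := by nlinarith
  rcases lt_or_ge b 43 with hb43 | hb43
  · have h15015 : 15015 ∣ b * c :=
      Nat.Coprime.mul_dvd_of_dvd_of_dvd (m := 1155) (by norm_num)
        (Nat.Coprime.mul_dvd_of_dvd_of_dvd (by norm_num) h105 h11) h13
    have := Nat.le_of_dvd hbc h15015
    nlinarith
  · obtain ⟨p, hp, hp1, hp2⟩ := Nat.exists_prime_lt_and_le_two_mul ((b - 1) / 2) (by omega)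
    obtain ⟨q, hq, hq1, hq2⟩ := Nat.exists_prime_lt_and_le_two_mul ((b - 1) / 2 / 2) (by omega)
    have hpd := h p hp (by omega) (hp.eq_two_or_odd.resolve_left (by omega))
    have hqd := h q hq (by omega) (hq.eq_two_or_odd.resolve_left (by omega))
    have hpq : q.Coprime p := (Nat.coprime_primes hq hp).2 (by omega)
    have hcop {r : ℕ} (hr : r.Prime) (h7r : 7 < r) : Nat.Coprime 105 r := by
      rw [Nat.coprime_comm, Nat.Prime.coprime_iff_not_dvd hr]
      intro hd
      rw [show 105 = 3 * 5 * 7 by norm_num, hr.dvd_mul, hr.dvd_mul] at hd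
      rcases hd with (hd | hd) | hd <;> have := Nat.le_of_dvd (by norm_num) hd <;> omega
    have hall : 105 * (q * p) ∣ b * c :=
      Nat.Coprime.mul_dvd_of_dvd_of_dvd (Nat.Coprime.mul_right (hcop hq (by omega))
        (hcop hp (by omega))) h105 (hpq.mul_dvd_of_dvd_of_dvd hqd hpd)
    have hle := Nat.le_of_dvd hbc hall
    have hpb : b ≤ 2 * p := by omega
    have hqb : b ≤ 4 * q := by omega
    have := Nat.mul_le_mul hqb hpb
    nlinarith

theorem le_of_forall_rep {b c : ℕ} (hb : 0 < b)
    (h : ∀ n < c, n % 2 = 1 → n.Coprime (b * c) → ∃ x y : ℕ, x ^ 2 + b * y ^ 2 = n) :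
    c ≤ 4 * b + (if b = 1 then 3 else 0) := by
  by_contra! hc
  have hc4 : 4 * b < c := by omega
  have hc8 : c < 8 * b := by
    refine lt_eight_mul_of_forall_prime_dvd hb hc4 fun q hq hqc hJ hodd => ?_
    by_contra hnd
    have hqb : ¬ q ∣ b := fun hd => by
      have : NeZero q := ⟨hq.ne_zero⟩
      have h0 : J(-(b : ℤ) | q) = 0 := by
        rw [jacobiSym.eq_zero_iff_not_coprime, Int.neg_gcd, Int.gcd_natCast_natCast]
        exact Nat.not_coprime_of_dvd_of_dvd hq.one_lt hd dvd_rfl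
      rw [hJ] at h0
      norm_num at h0
    obtain ⟨x, y, hxy⟩ := h q hqc hodd
      (hq.coprime_iff_not_dvd.2 fun hd => (hq.dvd_mul.1 hd).elim hqb hnd)
    exact prime_not_rep_of_jacobiSym_eq_neg_one hq hJ x y (by exact_mod_cast hxy)
  have hb14 : b < 14 := by
    refine lt_of_forall_prime_dvd (by omega) hc8 fun p hp hpb hodd => ?_
    by_contra hnd
    obtain ⟨x, y, hxy⟩ := h p (by omega) hodd (hp.coprime_iff_not_dvd.2 hnd)
    rcases Nat.eq_zero_or_pos y with rfl | hy
    · refine hp.not_isSquare ⟨x, ?_⟩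
      rw [← hxy]; ring
    · have : b * 1 ≤ b * y ^ 2 := Nat.mul_le_mul_left _ (Nat.one_le_pow _ _ hy)
      omega
  obtain ⟨n, hn, hodd, hcop, hne⟩ := exists_not_rep_of_lt_fourteen b
    (Finset.mem_Icc.2 ⟨hb, by omega⟩) c (Finset.mem_Ioo.2 ⟨hc, hc8⟩)
  rw [Finset.mem_range] at hn
  obtain ⟨x, y, hxy⟩ := h n hn hodd hcop
  refine hne x (Finset.mem_range.2 ?_) y (Finset.mem_range.2 ?_) hxy
  · nlinarith
  · nlinarith

theorem stmt18 (a b c : ℕ) (ha : 0 < a) (hab : a ≤ b) (hbc : b ≤ c)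
    (hab' : Nat.Coprime (ordCompl[2] a) (ordCompl[2] b))
    (hac' : Nat.Coprime (ordCompl[2] a) (ordCompl[2] c))
    (hbc' : Nat.Coprime (ordCompl[2] b) (ordCompl[2] c))
    (hsolv : ∀ n : ZMod 8, n = 1 ∨ n = 3 ∨ n = 5 ∨ n = 7 →
      ∃ x y z : ZMod 8, (a : ZMod 8) * x ^ 2 + (b : ZMod 8) * y ^ 2 + (c : ZMod 8) * z ^ 2 = n)
    (hreg : RegularTernaryForm a b c) :
    c ≤ 4 * a * b + (if a * b = 1 then 3 else 0) := by
  have hrep {n : ℕ} (hodd : n % 2 = 1) (hn : n.Coprime (a * b * c)) :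
      ∃ x y z : ℕ, a * x ^ 2 + b * y ^ 2 + c * z ^ 2 = n := by
    obtain ⟨x, y, z, h⟩ := hreg.exists_rep hab' hac' hbc' hsolv hodd hn
    refine ⟨x.natAbs, y.natAbs, z.natAbs, ?_⟩
    zify
    simpa only [sq_abs] using h
  have hpos {m t : ℕ} (ht : 0 < t) : m ≤ m * t ^ 2 :=
    Nat.le_mul_of_pos_right _ (Nat.pow_pos ht)
  obtain rfl : a = 1 := by
    obtain ⟨x, y, z, h⟩ := hrep (n := 1) rfl (Nat.coprime_one_left _)
    rcases Nat.eq_zero_or_pos x with rfl | hx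
    · rcases Nat.eq_zero_or_pos y with rfl | hy
      · rcases Nat.eq_zero_or_pos z with rfl | hz
        · simp at h
        · have := hpos (m := c) hz
          omega
      · have := hpos (m := b) hy
        omega
    · have := hpos (m := a) hx
      omega
  simp only [mul_one, one_mul] at hrep ⊢
  refine le_of_forall_rep hab fun n hn hodd hcop => ?_
  obtain ⟨x, y, z, h⟩ := hrep hodd hcop
  rcases Nat.eq_zero_or_pos z with rfl | hz
  · exact ⟨x, y, by simpa using h⟩
  · have := hpos (m := c) hz
    omega
end
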